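/- arXiv:2007.01600 — 6 statements merged into one kernel-verified Lean document; each statement's English description precedes it below -/
import Mathlib

section
/- Equation (‡) has at most one limit cycle (counted with multiplicity) with graph included in V if, for all t ∈ [0,T], one of the following conditions holds: (i) ā₁(t) ≠ 0 and there exists η ∈ ℝ such that ā₁(t)b̄₂(t) + η·ā₂(t)b̄₁(t) + ā₁'(t)/b̄₁(t) ≥ 0 for all t (or ≤ 0 for all t); (ii) ā₂(t) ≥ 0 for all t (or ≤ 0 for all t); (iii) either ā₁(t)ā₂(t) ≥ 0 and b̄₁(t)b̄₂(t) ≤ 0 for all t, or ā₁(t)ā₂(t) ≤ 0 and b̄₁(t)b̄₂(t) ≥ 0 for all t. -/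
open MeasureTheory Real Set

/-- `x` is a (global) solution of `x' = f t x`. -/
def IsSolution (f : ℝ → ℝ → ℝ) (x : ℝ → ℝ) : Prop :=
  ∀ t, HasDerivAt x (f t (x t)) t

/-- `x` is a `T`-periodic solution of `x' = f t x`. -/
def IsPeriodicSolution (f : ℝ → ℝ → ℝ) (T : ℝ) (x : ℝ → ℝ) : Prop :=
  IsSolution f x ∧ Function.Periodic x T

/-- `x` is a limit cycle: a `T`-periodic solution which is isolated in the set of
all `T`-periodic solutions (isolation measured through initial conditions). -/
def IsLimitCycle (f : ℝ → ℝ → ℝ) (T : ℝ) (x : ℝ → ℝ) : Prop :=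
  IsPeriodicSolution f T x ∧
    ∃ ε > 0, ∀ y : ℝ → ℝ, IsPeriodicSolution f T y → |y 0 - x 0| < ε → y 0 = x 0

open Classical in
/-- The region `V` (with `a₁ = A₁/B₁`): if `a₁ > 0` everywhere,
`V = {(t,x) : 0 < x < 1/a₁(t)}`; if `a₁ < 0` everywhere,
`V = {(t,x) : x > 0 ∨ x < 1/a₁(t)}`; otherwise (`a₁` has zeros)
`V = {(t,x) : x > 0 and x < 1/a₁(t) whenever a₁(t) > 0}`. -/
noncomputable def regionV (a₁ : ℝ → ℝ) : Set (ℝ × ℝ) :=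
  if ∀ t, 0 < a₁ t then {q | 0 < q.2 ∧ q.2 < 1 / a₁ q.1}
  else if ∀ t, a₁ t < 0 then {q | 0 < q.2 ∨ q.2 < 1 / a₁ q.1}
  else {q | 0 < q.2 ∧ (0 < a₁ q.1 → q.2 < 1 / a₁ q.1)}

/-- Right-hand side of the Abel equation (‡):
`x' = (A₁x − B₁)(A₂x − B₂)x + ((B₁' − A₁'x)/B₁)x`. -/
noncomputable def hlRHS (A₁ A₂ B₁ B₂ : ℝ → ℝ) (t x : ℝ) : ℝ :=
  (A₁ t * x - B₁ t) * (A₂ t * x - B₂ t) * x +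
    (deriv B₁ t - deriv A₁ t * x) / B₁ t * x

theorem forall_pos_or_forall_neg {g : ℝ → ℝ} (hg : Continuous g) (h : ∀ t, g t ≠ 0) :
    (∀ t, 0 < g t) ∨ (∀ t, g t < 0) := by
  by_contra! hc
  obtain ⟨⟨a, ha⟩, ⟨b, hb⟩⟩ := hc
  obtain ⟨t, ht⟩ := mem_range_of_exists_le_of_exists_ge hg ⟨a, ha⟩ ⟨b, hb⟩
  exact h t ht

theorem forall_of_forall_Icc_of_periodic {T : ℝ} (hT : 0 < T) {p : ℝ → Prop}
    (hp : Function.Periodic p T) (h : ∀ t ∈ Icc 0 T, p t) (t : ℝ) : p t := by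
  obtain ⟨s, hs, hst⟩ := hp.exists_mem_Ico₀ hT t
  rw [hst]
  exact h s ⟨hs.1, hs.2.le⟩

theorem Function.Periodic.deriv_real {f : ℝ → ℝ} {T : ℝ} (hf : Function.Periodic f T) :
    Function.Periodic (deriv f) T := by
  intro t
  rw [← deriv_comp_add_const f T t]
  exact congrArg (fun g => deriv g t) (funext hf)

/-- A continuous function of constant sign with zero integral vanishes. -/
theorem eq_zero_of_integral_eq_zero {a b : ℝ} (hab : a < b) {g : ℝ → ℝ} (hg : Continuous g)
    (hsign : (∀ t, 0 ≤ g t) ∨ (∀ t, g t ≤ 0)) (hint : ∫ t in a..b, g t = 0) :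
    ∀ t ∈ Icc a b, g t = 0 := by
  have key : ∀ f : ℝ → ℝ, Continuous f → (∀ t, 0 ≤ f t) → ∫ t in a..b, f t = 0 →
      ∀ t ∈ Icc a b, f t = 0 := by
    intro f hf h0 hi t ht
    by_contra hne
    exact (intervalIntegral.integral_pos hab hf.continuousOn (fun s _ => h0 s)
      ⟨t, ht, lt_of_le_of_ne (h0 t) (Ne.symm hne)⟩).ne' hi
  rcases hsign with h | h
  · exact key g hg h hint
  · intro t ht
    have := key (fun t => -g t) hg.neg (fun t => neg_nonneg.2 (h t)) (by simp [hint]) t ht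
    simpa using this

/-- Along a periodic solution of `y' = F(y) k(t)` avoiding the zeros of `F`, the mean of `k`
vanishes. -/
theorem integral_eq_zero_of_periodic {T : ℝ} {y k F : ℝ → ℝ} (hF : Continuous F)
    (hk : Continuous k) (hy : ∀ t, HasDerivAt y (F (y t) * k t) t)
    (hper : Function.Periodic y T) (hne : ∀ t, F (y t) ≠ 0) : ∫ t in (0 : ℝ)..T, k t = 0 := by
  have hyc : Continuous y := continuous_iff_continuousAt.2 fun t => (hy t).continuousAt
  have h := intervalIntegral.integral_comp_mul_deriv'' (a := 0) (b := T) (f := y)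
    (f' := fun t => F (y t) * k t) (g := fun z => (F z)⁻¹) hyc.continuousOn
    (fun t _ => (hy t).hasDerivWithinAt) (by fun_prop)
    (hF.continuousOn.inv₀ (by rintro _ ⟨t, -, rfl⟩; exact hne t))
  have h0 : y T = y 0 := by simpa using hper 0
  rw [h0, intervalIntegral.integral_same] at h
  refine Eq.trans (intervalIntegral.integral_congr fun t _ => ?_) h
  simp only [Function.comp]
  field_simp [hne t]

theorem hasDerivAt_mul_exp_neg_integral {f K s : ℝ → ℝ} (hK : Continuous K)
    (hf : ∀ t, HasDerivAt f (K t * f t + s t) t) (a t : ℝ) :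
    HasDerivAt (fun t => f t * exp (-∫ r in a..t, K r)) (s t * exp (-∫ r in a..t, K r)) t :=
  ((hf t).mul (hK.integral_hasStrictDerivAt a t).hasDerivAt.neg.exp).congr_deriv
    (by simp only [Pi.neg_apply]; ring)

/-- A solution of a homogeneous linear equation with a zero vanishes identically. -/
theorem eq_zero_of_hasDerivAt_mul {f K : ℝ → ℝ} (hK : Continuous K)
    (hf : ∀ t, HasDerivAt f (K t * f t) t) {a : ℝ} (ha : f a = 0) (t : ℝ) : f t = 0 := by
  have h := hasDerivAt_mul_exp_neg_integral (s := 0) hK (fun t => by simpa using hf t) a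
  have hc := is_const_of_deriv_eq_zero (fun t => (h t).differentiableAt)
    (fun t => by simpa using (h t).deriv) t a
  simpa [ha] using hc

/-- If a periodic solution of `f' = K f + s`, with `s` of constant sign, has a zero, then `s`
vanishes over the following period. -/
theorem eq_zero_of_periodic_of_zero {T : ℝ} (hT : 0 < T) {f K s : ℝ → ℝ} (hK : Continuous K)
    (hs : Continuous s) (hsign : (∀ t, 0 ≤ s t) ∨ (∀ t, s t ≤ 0))
    (hf : ∀ t, HasDerivAt f (K t * f t + s t) t) (hper : Function.Periodic f T)
    {a : ℝ} (ha : f a = 0) : ∀ t ∈ Icc a (a + T), s t = 0 := by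
  have h := hasDerivAt_mul_exp_neg_integral hK hf a
  have hexp : Continuous fun t => exp (-∫ r in a..t, K r) := by
    refine continuous_exp.comp (continuous_iff_continuousAt.2 fun t => ?_)
    exact (hK.integral_hasStrictDerivAt a t).hasDerivAt.neg.continuousAt
  have hint := intervalIntegral.integral_eq_sub_of_hasDerivAt (a := a) (b := a + T)
    (fun t _ => h t) ((hs.mul hexp).intervalIntegrable _ _)
  rw [hper a, ha] at hint
  have := eq_zero_of_integral_eq_zero (lt_add_of_pos_right a hT) (hs.mul hexp)
    (hsign.imp (fun h t => mul_nonneg (h t) (exp_pos _).le)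
      (fun h t => mul_nonpos_of_nonpos_of_nonneg (h t) (exp_pos _).le)) (by simpa using hint)
  intro t ht
  simpa [(exp_pos _).ne'] using this t ht

theorem exists_pos_bounds_of_periodic {T : ℝ} (hT : 0 < T) {f : ℝ → ℝ} (hf : Continuous f)
    (hper : Function.Periodic f T) (hpos : ∀ t, 0 < f t) :
    ∃ c C, 0 < c ∧ ∀ t, c ≤ f t ∧ f t ≤ C := by
  have hne : (Icc 0 T).Nonempty := nonempty_Icc.2 hT.le
  obtain ⟨a, -, ha⟩ := isCompact_Icc.exists_isMinOn hne hf.continuousOn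
  obtain ⟨b, -, hb⟩ := isCompact_Icc.exists_isMaxOn hne hf.continuousOn
  refine ⟨f a, f b, hpos a, forall_of_forall_Icc_of_periodic hT ?_ fun t ht => ⟨ha ht, hb ht⟩⟩
  intro t
  simp only [hper t]

/-- The flow of a bounded positive autonomous field, through its inverse time function. -/
theorem exists_time_function {F : ℝ → ℝ} (hF : Continuous F) {c C : ℝ} (hc : 0 < c)
    (hbd : ∀ z, c ≤ F z ∧ F z ≤ C) :
    ∃ G φ : ℝ → ℝ, (∀ z, HasDerivAt G (F z)⁻¹ z) ∧ (∀ s, HasDerivAt φ (F (φ s)) s) ∧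
      (∀ z, φ (G z) = z) ∧ (∀ s, G (φ s) = s) ∧ ∀ a b, |φ a - φ b| ≤ C * |a - b| := by
  have hpos : ∀ z, 0 < F z := fun z => hc.trans_le (hbd z).1
  have hC : 0 < C := (hpos 0).trans_le (hbd 0).2
  have hFi : Continuous fun z => (F z)⁻¹ := hF.inv₀ fun z => (hpos z).ne'
  set G : ℝ → ℝ := fun z => ∫ r in (0 : ℝ)..z, (F r)⁻¹ with hGdef
  have hG : ∀ z, HasDerivAt G (F z)⁻¹ z := fun z =>
    (hFi.integral_hasStrictDerivAt 0 z).hasDerivAt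
  have hGd : Differentiable ℝ G := fun z => (hG z).differentiableAt
  have hlow : ∀ ⦃w z⦄, w ≤ z → C⁻¹ * (z - w) ≤ G z - G w :=
    mul_sub_le_image_sub_of_le_deriv hGd fun z => by
      rw [(hG z).deriv]
      exact inv_anti₀ (hpos z) (hbd z).2
  have hmono : StrictMono G := strictMono_of_deriv_pos fun z => by
    rw [(hG z).deriv]; exact inv_pos.2 (hpos z)
  have hG0 : G 0 = 0 := by simp [hGdef]
  have hsurj : Function.Surjective G := by
    refine hGd.continuous.surjective ?_ ?_
    · refine Filter.tendsto_atTop_mono' _ ?_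
        (Filter.tendsto_id.const_mul_atTop (inv_pos.2 hC))
      filter_upwards [Filter.eventually_ge_atTop 0] with z hz
      simpa [hG0] using hlow hz
    · refine Filter.tendsto_atBot_mono' _ ?_
        (Filter.tendsto_id.const_mul_atBot (inv_pos.2 hC))
      filter_upwards [Filter.eventually_le_atBot 0] with z hz
      have := hlow hz
      simp only [hG0, id] at this ⊢
      linarith
  let e := hmono.orderIsoOfSurjective G hsurj
  have hleft : ∀ z, e.symm (G z) = z := fun z => e.symm_apply_apply z
  have hright : ∀ s, G (e.symm s) = s := fun s => e.apply_symm_apply s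
  refine ⟨G, e.symm, hG, fun s => ?_, hleft, hright, ?_⟩
  · have := HasDerivAt.of_local_left_inverse (f := G) (g := e.symm) (a := s)
      e.symm.continuous.continuousAt (hG _) (inv_pos.2 (hpos _)).ne'
      (Filter.Eventually.of_forall hright)
    simpa using this
  · have key : ∀ a b, a ≤ b → |e.symm a - e.symm b| ≤ C * |a - b| := by
      intro a b hab
      have h1 : e.symm a ≤ e.symm b := e.symm.monotone hab
      have h2 := hlow h1
      rw [hright, hright, inv_mul_le_iff₀ hC] at h2
      rw [abs_sub_comm, abs_of_nonneg (sub_nonneg.2 h1), abs_sub_comm,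
        abs_of_nonneg (sub_nonneg.2 hab)]
      exact h2
    intro a b
    rcases le_total a b with h | h
    · exact key a b h
    · rw [abs_sub_comm, abs_sub_comm a b]
      exact key b a h

/-- Periodic solutions of a separable equation avoiding equilibria are never isolated. -/
theorem exists_periodic_near_of_separable {T : ℝ} (hT : 0 < T) {y P F : ℝ → ℝ}
    (hF : Continuous F) (hy : ∀ t, HasDerivAt y (F (y t) * P t) t)
    (hper : Function.Periodic y T) (hne : ∀ t, F (y t) ≠ 0) {ε : ℝ} (hε : 0 < ε) :
    ∃ z : ℝ → ℝ, (∀ t, HasDerivAt z (F (z t) * P t) t) ∧ Function.Periodic z T ∧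
      (∀ t, |z t - y t| < ε) ∧ z 0 ≠ y 0 := by
  have hyc : Continuous y := continuous_iff_continuousAt.2 fun t => (hy t).continuousAt
  wlog hpos : ∀ t, 0 < F (y t) generalizing P F
  · have hneg := (forall_pos_or_forall_neg (hF.comp hyc) hne).resolve_left hpos
    obtain ⟨z, hz, h⟩ := this (P := fun t => -P t) (F := fun z => -F z) hF.neg
      (fun t => by simpa using hy t) (fun t => neg_ne_zero.2 (hne t))
      (fun t => neg_pos.2 (hneg t))
    exact ⟨z, fun t => by simpa using hz t, h⟩
  obtain ⟨c, C, hc, hcC⟩ := exists_pos_bounds_of_periodic hT (hF.comp hyc)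
    (fun t => congrArg F (hper t)) hpos
  simp only [Function.comp] at hcC
  have hCpos : 0 < C := (hc.trans_le (hcC 0).1).trans_le (hcC 0).2
  set H : ℝ → ℝ := fun z => max (c / 2) (min (F z) (2 * C)) with hHdef
  have hcle : c ≤ C := (hcC 0).1.trans (hcC 0).2
  have hH : ∀ z, c / 2 < F z → F z < 2 * C → H z = F z := fun z h1 h2 => by
    simp only [hHdef]
    rw [min_eq_left h2.le, max_eq_right h1.le]
  have hHy : ∀ t, H (y t) = F (y t) := fun t =>
    hH _ (by linarith [(hcC t).1]) (by linarith [(hcC t).2])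
  obtain ⟨δ, hδ, hδU⟩ := (isCompact_Icc (a := (0 : ℝ)) (b := T)).image hyc
    |>.exists_thickening_subset_open
    ((isOpen_lt continuous_const hF).inter (isOpen_lt hF continuous_const) :
      IsOpen ({z | c / 2 < F z} ∩ {z | F z < 2 * C}))
    (by
      rintro _ ⟨t, -, rfl⟩
      exact ⟨by simp only [mem_ofPred_eq]; linarith [(hcC t).1],
        by simp only [mem_ofPred_eq]; linarith [(hcC t).2]⟩)
  have hrange : y '' Icc 0 T = range y := by simpa using hper.image_Icc hT 0
  obtain ⟨G, φ, hG, hφ, hφG, hGφ, hlip⟩ := exists_time_function (F := H) (c := c / 2) (C := 2 * C)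
    (by fun_prop) (by linarith)
    (fun z => ⟨le_max_left _ _, max_le (by linarith) (min_le_right _ _)⟩)
  obtain ⟨s, hs, hsε, hsδ⟩ : ∃ s : ℝ, 0 < s ∧ 2 * C * s < ε ∧ 2 * C * s < δ := by
    refine ⟨min ε δ / (4 * C), by positivity, ?_, ?_⟩
    all_goals
      have h1 : 2 * C * (min ε δ / (4 * C)) = min ε δ / 2 := by field_simp; norm_num
      rw [h1]
      linarith [lt_min hε hδ, min_le_left ε δ, min_le_right ε δ]
  have hdist : ∀ t, |φ (G (y t) + s) - y t| ≤ 2 * C * s := by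
    intro t
    have := hlip (G (y t) + s) (G (y t))
    rwa [hφG, add_sub_cancel_left, abs_of_pos hs] at this
  have hHz : ∀ t, H (φ (G (y t) + s)) = F (φ (G (y t) + s)) := by
    intro t
    have hmem : φ (G (y t) + s) ∈ Metric.thickening δ (y '' Icc 0 T) := by
      rw [Metric.mem_thickening_iff]
      refine ⟨y t, hrange ▸ mem_range_self t, ?_⟩
      rw [Real.dist_eq]
      exact (hdist t).trans_lt hsδ
    exact hH _ (hδU hmem).1 (hδU hmem).2
  refine ⟨fun t => φ (G (y t) + s), fun t => ?_, fun t => by simp only [hper t],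
    fun t => (hdist t).trans_lt hsε, fun h0 => ?_⟩
  · have h1 : HasDerivAt (fun t => G (y t) + s) (P t) t := by
      refine (((hG (y t)).comp t (hy t)).add_const s).congr_deriv ?_
      rw [hHy]
      field_simp [hne t]
    have h2 := (hφ (G (y t) + s)).comp t h1
    rw [hHz] at h2
    exact h2
  · have := congrArg G h0
    simp only [hGφ] at this
    linarith

theorem mul_sign_of_ne_zero {s g : ℝ → ℝ} (hs : (∀ t, 0 ≤ s t) ∨ (∀ t, s t ≤ 0))
    (hg : Continuous g) (hne : ∀ t, g t ≠ 0) :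
    (∀ t, 0 ≤ s t * g t) ∨ (∀ t, s t * g t ≤ 0) := by
  rcases hs with hs | hs <;> rcases forall_pos_or_forall_neg hg hne with h | h
  · exact Or.inl fun t => mul_nonneg (hs t) (h t).le
  · exact Or.inr fun t => mul_nonpos_of_nonneg_of_nonpos (hs t) (h t).le
  · exact Or.inr fun t => mul_nonpos_of_nonpos_of_nonneg (hs t) (h t).le
  · exact Or.inl fun t => mul_nonneg_of_nonpos_of_nonpos (hs t) (h t).le

theorem eq_zero_of_integral_mul_eq_zero {T : ℝ} (hT : 0 < T) {s g : ℝ → ℝ} (hsc : Continuous s)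
    (hper : Function.Periodic s T) (hs : (∀ t, 0 ≤ s t) ∨ (∀ t, s t ≤ 0)) (hg : Continuous g)
    (hne : ∀ t, g t ≠ 0) (hint : ∫ t in (0 : ℝ)..T, s t * g t = 0) (t : ℝ) : s t = 0 := by
  refine forall_of_forall_Icc_of_periodic hT (p := fun t => s t = 0)
    (fun t => by simp only [hper t]) (fun t ht => ?_) t
  have := eq_zero_of_integral_eq_zero hT (hsc.mul hg) (mul_sign_of_ne_zero hs hg hne) hint t ht
  exact (mul_eq_zero.1 this).resolve_right (hne t)

theorem IsSolution.continuous {f : ℝ → ℝ → ℝ} {x : ℝ → ℝ} (hx : IsSolution f x) :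
    Continuous x :=
  continuous_iff_continuousAt.2 fun t => (hx t).continuousAt

/-- The factorised Riccati-type cubic `y' = y (y - 1) (P (y + η) - R)` with `R` of constant sign:
two disjoint periodic solutions avoiding `0` and `1` force `R = 0`. -/
theorem eq_zero_of_two_periodic {T : ℝ} (hT : 0 < T) {y z P R : ℝ → ℝ} {η : ℝ}
    (hP : Continuous P) (hR : Continuous R) (hRper : Function.Periodic R T)
    (hsign : (∀ t, 0 ≤ R t) ∨ (∀ t, R t ≤ 0))
    (hy : IsPeriodicSolution (fun t y => y * (y - 1) * (P t * (y + η) - R t)) T y)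
    (hz : IsPeriodicSolution (fun t y => y * (y - 1) * (P t * (y + η) - R t)) T z)
    (hy0 : ∀ t, y t ≠ 0) (hy1 : ∀ t, y t - 1 ≠ 0) (hz0 : ∀ t, z t ≠ 0) (hz1 : ∀ t, z t - 1 ≠ 0)
    (hyz : ∀ t, y t ≠ z t) (t : ℝ) : R t = 0 := by
  have hyc := hy.1.continuous
  have hzc := hz.1.continuous
  have hzero : ∀ w : ℝ → ℝ,
      IsPeriodicSolution (fun t y => y * (y - 1) * (P t * (y + η) - R t)) T w →
      (∀ t, w t ≠ 0) → (∀ t, w t - 1 ≠ 0) → ∀ a, w a + η = 0 → ∀ t, R t = 0 := by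
    intro w hw hw0 hw1 a ha
    have hwc := hw.1.continuous
    have hg : Continuous fun t => -(w t * (w t - 1)) := by fun_prop
    have hgne : ∀ t, -(w t * (w t - 1)) ≠ 0 := fun t =>
      neg_ne_zero.2 (mul_ne_zero (hw0 t) (hw1 t))
    have h := eq_zero_of_periodic_of_zero hT (f := fun t => w t + η)
      (K := fun t => w t * (w t - 1) * P t) (s := fun t => R t * -(w t * (w t - 1)))
      (by fun_prop) (by fun_prop) (mul_sign_of_ne_zero hsign hg hgne)
      (fun t => ((hw.1 t).add_const η).congr_deriv (by ring))
      (fun t => by simp only [hw.2 t]) ha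
    intro t
    obtain ⟨s, hs, hst⟩ := hRper.exists_mem_Ico hT t a
    rw [hst]
    exact (mul_eq_zero.1 (h s ⟨hs.1, hs.2.le⟩)).resolve_right (hgne s)
  by_cases hfy : ∃ a, y a + η = 0
  · exact hfy.elim fun a ha => hzero y hy hy0 hy1 a ha t
  by_cases hfz : ∃ a, z a + η = 0
  · exact hfz.elim fun a ha => hzero z hz hz0 hz1 a ha t
  push Not at hfy hfz
  have hint : ∀ w : ℝ → ℝ,
      IsPeriodicSolution (fun t y => y * (y - 1) * (P t * (y + η) - R t)) T w →
      (∀ t, w t ≠ 0) → (∀ t, w t - 1 ≠ 0) → (∀ t, w t + η ≠ 0) →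
      Continuous (fun t => P t - R t / (w t + η)) ∧
        ∫ t in (0 : ℝ)..T, (P t - R t / (w t + η)) = 0 := by
    intro w hw hw0 hw1 hwf
    have hwc := hw.1.continuous
    have hc : Continuous fun t => P t - R t / (w t + η) :=
      hP.sub (hR.div (by fun_prop) hwf)
    refine ⟨hc, integral_eq_zero_of_periodic (F := fun v => v * (v - 1) * (v + η)) (by fun_prop)
      hc (fun t => (hw.1 t).congr_deriv ?_) hw.2
      fun t => mul_ne_zero (mul_ne_zero (hw0 t) (hw1 t)) (hwf t)⟩
    field_simp [hwf t]
  obtain ⟨hcy, hiy⟩ := hint y hy hy0 hy1 hfy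
  obtain ⟨hcz, hiz⟩ := hint z hz hz0 hz1 hfz
  refine eq_zero_of_integral_mul_eq_zero hT hR hRper hsign
    (g := fun t => (z t + η)⁻¹ - (y t + η)⁻¹)
    (((hzc.add continuous_const).inv₀ hfz).sub ((hyc.add continuous_const).inv₀ hfy)) ?_ ?_ t
  · intro t h
    exact hyz t (by linarith [inv_injective (sub_eq_zero.1 h)])
  · calc ∫ t in (0 : ℝ)..T, R t * ((z t + η)⁻¹ - (y t + η)⁻¹)
        = ∫ t in (0 : ℝ)..T, ((P t - R t / (y t + η)) - (P t - R t / (z t + η))) :=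
          intervalIntegral.integral_congr fun t _ => by ring
      _ = 0 := by
          rw [intervalIntegral.integral_sub (hcy.intervalIntegrable _ _)
            (hcz.intervalIntegrable _ _), hiy, hiz, sub_zero]

/-- The right-hand side of the equation satisfied by `p = B₁ / x` when `x` solves (‡). -/
noncomputable def recipRHS (A₁ A₂ B₁ B₂ : ℝ → ℝ) (t p : ℝ) : ℝ :=
  deriv A₁ t + (p - A₁ t) * (B₁ t ^ 2 * A₂ t / p - B₁ t * B₂ t)

section Transform

variable {T : ℝ} {A₁ A₂ B₁ B₂ : ℝ → ℝ}

theorem IsPeriodicSolution.recip (hB₁ : Differentiable ℝ B₁) (hB₁per : Function.Periodic B₁ T)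
    (hB₁ne : ∀ t, B₁ t ≠ 0) {x : ℝ → ℝ} (hx : IsPeriodicSolution (hlRHS A₁ A₂ B₁ B₂) T x)
    (hx0 : ∀ t, x t ≠ 0) :
    IsPeriodicSolution (recipRHS A₁ A₂ B₁ B₂) T fun t => B₁ t / x t := by
  refine ⟨fun t => ((hB₁ t).hasDerivAt.div (hx.1 t) (hx0 t)).congr_deriv ?_,
    fun t => by simp only [hB₁per t, hx.2 t]⟩
  have h1 := hB₁ne t
  have h2 := hx0 t
  simp only [hlRHS, recipRHS]
  field_simp
  ring

theorem IsPeriodicSolution.of_recip (hB₁ : Differentiable ℝ B₁)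
    (hB₁per : Function.Periodic B₁ T) (hB₁ne : ∀ t, B₁ t ≠ 0) {p : ℝ → ℝ}
    (hp : IsPeriodicSolution (recipRHS A₁ A₂ B₁ B₂) T p) (hp0 : ∀ t, p t ≠ 0) :
    IsPeriodicSolution (hlRHS A₁ A₂ B₁ B₂) T fun t => B₁ t / p t := by
  refine ⟨fun t => ((hB₁ t).hasDerivAt.div (hp.1 t) (hp0 t)).congr_deriv ?_,
    fun t => by simp only [hB₁per t, hp.2 t]⟩
  have h1 := hB₁ne t
  have h2 := hp0 t
  simp only [hlRHS, recipRHS]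
  field_simp
  ring

/-- A nonvanishing periodic solution of the reciprocal equation which is isolated among the
nonvanishing periodic solutions. -/
def IsRecipLimitCycle (T : ℝ) (A₁ A₂ B₁ B₂ p : ℝ → ℝ) : Prop :=
  IsPeriodicSolution (recipRHS A₁ A₂ B₁ B₂) T p ∧ (∀ t, p t ≠ 0) ∧
    ∃ ε > 0, ∀ q : ℝ → ℝ, IsPeriodicSolution (recipRHS A₁ A₂ B₁ B₂) T q → (∀ t, q t ≠ 0) →
      |q 0 - p 0| < ε → q 0 = p 0

theorem IsLimitCycle.recip (hB₁ : Differentiable ℝ B₁) (hB₁per : Function.Periodic B₁ T)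
    (hB₁ne : ∀ t, B₁ t ≠ 0) {x : ℝ → ℝ} (hx : IsLimitCycle (hlRHS A₁ A₂ B₁ B₂) T x)
    (hx0 : ∀ t, x t ≠ 0) : IsRecipLimitCycle T A₁ A₂ B₁ B₂ fun t => B₁ t / x t := by
  obtain ⟨hxp, ε, hε, hiso⟩ := hx
  have hp0 : ∀ t, B₁ t / x t ≠ 0 := fun t => div_ne_zero (hB₁ne t) (hx0 t)
  refine ⟨hxp.recip hB₁ hB₁per hB₁ne hx0, hp0, ?_⟩
  have hcont : ContinuousAt (fun r => B₁ 0 / r) (B₁ 0 / x 0) :=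
    continuousAt_const.div continuousAt_id (hp0 0)
  obtain ⟨δ, hδ, hnear⟩ := Metric.continuousAt_iff.1 hcont ε hε
  have hback : B₁ 0 / (B₁ 0 / x 0) = x 0 := div_div_cancel₀ (hB₁ne 0)
  refine ⟨δ, hδ, fun q hq hq0 hqp => ?_⟩
  have h := hnear (x := q 0) (by rwa [Real.dist_eq])
  simp only [hback, Real.dist_eq] at h
  beta_reduce
  rw [← hiso _ (hq.of_recip hB₁ hB₁per hB₁ne hq0) h, div_div_cancel₀ (hB₁ne 0)]

/-- An isolated solution cannot be a translate of a nonequilibrium solution of a separable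
equation. -/
theorem not_isRecipLimitCycle_of_separable_sub (hT : 0 < T) {A P F p : ℝ → ℝ}
    (hA : Differentiable ℝ A) (hAper : Function.Periodic A T) (hF : Continuous F)
    (hsep : ∀ t r, r ≠ 0 → recipRHS A₁ A₂ B₁ B₂ t r = deriv A t + F (r - A t) * P t)
    (hne : ∀ t, F (p t - A t) ≠ 0) : ¬ IsRecipLimitCycle T A₁ A₂ B₁ B₂ p := by
  rintro ⟨hp, hp0, ε, hε, hiso⟩
  obtain ⟨c, C, hc, hcp⟩ := exists_pos_bounds_of_periodic hT hp.1.continuous.abs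
    (fun t => by simp only [hp.2 t]) fun t => abs_pos.2 (hp0 t)
  obtain ⟨z, hz, hzper, hzy, hz0⟩ := exists_periodic_near_of_separable hT
    (y := fun t => p t - A t) (P := P) hF
    (fun t => ((hp.1 t).sub (hA t).hasDerivAt).congr_deriv (by rw [hsep t _ (hp0 t)]; ring))
    (fun t => by simp only [hp.2 t, hAper t]) hne (lt_min hε hc)
  have hd : ∀ t, |z t + A t - p t| < min ε c := fun t => by
    convert hzy t using 2; ring
  have hq0 : ∀ t, z t + A t ≠ 0 := fun t h => by
    have h1 := hd t
    rw [h, zero_sub, abs_neg] at h1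
    exact (h1.trans_le (min_le_right _ _)).not_ge (hcp t).1
  have := hiso (fun t => z t + A t)
    ⟨fun t => ((hz t).add (hA t).hasDerivAt).congr_deriv (by
      rw [hsep t _ (hq0 t), add_sub_cancel_right]; ring),
      fun t => by simp only [hzper t, hAper t]⟩ hq0 ((hd 0).trans_le (min_le_left _ _))
  exact hz0 (by linarith)

theorem IsPeriodicSolution.div_recip (hA₁ : Differentiable ℝ A₁)
    (hA₁per : Function.Periodic A₁ T) (hA₁ne : ∀ t, A₁ t ≠ 0) {P R : ℝ → ℝ} {η : ℝ}
    (hP : ∀ t, P t = B₁ t ^ 2 * A₂ t / A₁ t)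
    (hR : ∀ t, R t = B₁ t * B₂ t + deriv A₁ t / A₁ t + η * P t)
    {p : ℝ → ℝ} (hp0 : ∀ t, p t ≠ 0) (hp : IsPeriodicSolution (recipRHS A₁ A₂ B₁ B₂) T p) :
    IsPeriodicSolution (fun t y => y * (y - 1) * (P t * (y + η) - R t)) T
      fun t => A₁ t / p t := by
  refine ⟨fun t => ((hA₁ t).hasDerivAt.div (hp.1 t) (hp0 t)).congr_deriv ?_,
    fun t => by simp only [hA₁per t, hp.2 t]⟩
  have h1 := hA₁ne t
  have h2 := hp0 t
  simp only [hR, hP, recipRHS]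
  field_simp
  ring

theorem not_isRecipLimitCycle_of_separable_div (hT : 0 < T) (hA₁ : Differentiable ℝ A₁)
    (hA₁per : Function.Periodic A₁ T) (hA₁ne : ∀ t, A₁ t ≠ 0) {P : ℝ → ℝ} {η : ℝ}
    (hP : ∀ t, P t = B₁ t ^ 2 * A₂ t / A₁ t)
    (hR : ∀ t, B₁ t * B₂ t + deriv A₁ t / A₁ t + η * P t = 0)
    {p : ℝ → ℝ} (h1 : ∀ t, A₁ t / p t - 1 ≠ 0) (hη : ∀ t, A₁ t / p t + η ≠ 0) :
    ¬ IsRecipLimitCycle T A₁ A₂ B₁ B₂ p := by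
  rintro ⟨hp, hp0, ε, hε, hiso⟩
  have hy := IsPeriodicSolution.div_recip hA₁ hA₁per hA₁ne hP (fun t => (hR t).symm) hp0 hp
  have hy0 : ∀ t, A₁ t / p t ≠ 0 := fun t => div_ne_zero (hA₁ne t) (hp0 t)
  obtain ⟨c, C, hc, hcp⟩ := exists_pos_bounds_of_periodic hT hy.1.continuous.abs
    (fun t => congrArg abs (hy.2 t)) fun t => abs_pos.2 (hy0 t)
  have hcont : ContinuousAt (fun r => A₁ 0 / r) (A₁ 0 / p 0) :=
    continuousAt_const.div continuousAt_id (hy0 0)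
  obtain ⟨δ, hδ, hnear⟩ := Metric.continuousAt_iff.1 hcont ε hε
  obtain ⟨z, hz, hzper, hzy, hz0⟩ := exists_periodic_near_of_separable hT
    (y := fun t => A₁ t / p t) (P := P) (F := fun v => v * (v - 1) * (v + η)) (by fun_prop)
    (fun t => (hy.1 t).congr_deriv (by ring)) hy.2
    (fun t => mul_ne_zero (mul_ne_zero (hy0 t) (h1 t)) (hη t)) (lt_min hδ hc)
  have hzne : ∀ t, z t ≠ 0 := fun t h => by
    have h1 := hzy t
    rw [h, zero_sub, abs_neg] at h1
    exact (h1.trans_le (min_le_right _ _)).not_ge (hcp t).1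
  have hq0 : ∀ t, A₁ t / z t ≠ 0 := fun t => div_ne_zero (hA₁ne t) (hzne t)
  have hd := hnear (x := z 0) (by rw [Real.dist_eq]; exact (hzy 0).trans_le (min_le_left _ _))
  rw [Real.dist_eq, div_div_cancel₀ (hA₁ne 0)] at hd
  have := hiso (fun t => A₁ t / z t)
    ⟨fun t => ((hA₁ t).hasDerivAt.div (hz t) (hzne t)).congr_deriv (by
        have e1 := hA₁ne t
        have e2 := hzne t
        have e3 : B₁ t * B₂ t = -(deriv A₁ t / A₁ t + η * P t) := by linarith [hR t]
        simp only [recipRHS]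
        rw [e3, hP]
        field_simp
        ring),
      fun t => by simp only [hzper t, hA₁per t]⟩ hq0 hd
  apply hz0
  rw [← div_div_cancel₀ (hA₁ne 0) (b := z 0), this]

end Transform

theorem ne_zero_and_lt_inv_of_mem_regionV {a x : ℝ → ℝ} (h : ∀ t, (t, x t) ∈ regionV a) :
    (∀ t, x t ≠ 0 ∧ a t < 1 / x t) ∧ ((∃ t, a t = 0) → ∀ t, 0 < x t) := by
  unfold regionV at h
  split_ifs at h with hpos hneg
  · exact ⟨fun t => ⟨(h t).1.ne', (lt_one_div (h t).1 (hpos t)).1 (h t).2⟩, fun _ t => (h t).1⟩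
  · refine ⟨fun t => ?_, fun ⟨s, hs⟩ => absurd hs (hneg s).ne⟩
    rcases h t with hx | hx
    · exact ⟨hx.ne', (hneg t).trans (one_div_pos.2 hx)⟩
    · have hx0 : x t < 0 := hx.trans (one_div_neg.2 (hneg t))
      exact ⟨hx0.ne, (lt_one_div_of_neg hx0 (hneg t)).1 hx⟩
  · refine ⟨fun t => ⟨(h t).1.ne', ?_⟩, fun _ t => (h t).1⟩
    rcases lt_or_ge 0 (a t) with ha | ha
    · exact (lt_one_div (h t).1 ha).1 ((h t).2 ha)
    · exact ha.trans_lt (one_div_pos.2 (h t).1)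

theorem ne_of_periodicSolution_of_ne {T : ℝ} {A₁ A₂ B₁ B₂ : ℝ → ℝ} (hA₁ : Continuous A₁)
    (hA₂ : Continuous A₂) (hB₁ : Continuous B₁) (hB₂ : Continuous B₂)
    (hA₁' : Continuous (deriv A₁)) (hB₁' : Continuous (deriv B₁)) (hB₁ne : ∀ t, B₁ t ≠ 0)
    {x y : ℝ → ℝ} (hx : IsPeriodicSolution (hlRHS A₁ A₂ B₁ B₂) T x)
    (hy : IsPeriodicSolution (hlRHS A₁ A₂ B₁ B₂) T y) (hxy : x ≠ y) (t : ℝ) : x t ≠ y t := by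
  have hxc := hx.1.continuous
  have hyc := hy.1.continuous
  intro h
  refine hxy (funext fun s => sub_eq_zero.1 ?_)
  refine eq_zero_of_hasDerivAt_mul (f := fun s => x s - y s)
    (K := fun t => A₁ t * A₂ t * (x t ^ 2 + x t * y t + y t ^ 2)
      - (A₁ t * B₂ t + A₂ t * B₁ t) * (x t + y t) + B₁ t * B₂ t
      + (deriv B₁ t - deriv A₁ t * (x t + y t)) / B₁ t) ?_ ?_ (sub_eq_zero.2 h) s
  · exact Continuous.add (by fun_prop) (Continuous.div (by fun_prop) hB₁ hB₁ne)
  · intro t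
    refine ((hx.1 t).sub (hy.1 t)).congr_deriv ?_
    have := hB₁ne t
    simp only [hlRHS]
    field_simp
    ring

section Criteria

variable {T : ℝ} {A₁ A₂ B₁ B₂ p q : ℝ → ℝ}

/-- If `A₂` has constant sign, two disjoint periodic solutions cannot be isolated. -/
theorem not_two_recipLimitCycles_of_sign (hT : 0 < T) (hA₁ : Differentiable ℝ A₁)
    (hA₂ : Continuous A₂) (hB₁ : Continuous B₁) (hB₂ : Continuous B₂)
    (hA₁per : Function.Periodic A₁ T) (hA₂per : Function.Periodic A₂ T)
    (hB₁ne : ∀ t, B₁ t ≠ 0) (hsign : (∀ t, 0 ≤ A₂ t) ∨ (∀ t, A₂ t ≤ 0))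
    (hp : IsRecipLimitCycle T A₁ A₂ B₁ B₂ p) (hq : IsRecipLimitCycle T A₁ A₂ B₁ B₂ q)
    (hpA : ∀ t, p t - A₁ t ≠ 0) (hqA : ∀ t, q t - A₁ t ≠ 0) (hpq : ∀ t, p t ≠ q t) : False := by
  have hint : ∀ r : ℝ → ℝ, IsRecipLimitCycle T A₁ A₂ B₁ B₂ r → (∀ t, r t - A₁ t ≠ 0) →
      Continuous (fun t => B₁ t ^ 2 * A₂ t / r t - B₁ t * B₂ t) ∧
        ∫ t in (0 : ℝ)..T, (B₁ t ^ 2 * A₂ t / r t - B₁ t * B₂ t) = 0 := by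
    intro r hr hrA
    have hc : Continuous fun t => B₁ t ^ 2 * A₂ t / r t - B₁ t * B₂ t :=
      (Continuous.div (by fun_prop) hr.1.1.continuous hr.2.1).sub (by fun_prop)
    refine ⟨hc, integral_eq_zero_of_periodic (y := fun t => r t - A₁ t) (F := fun v => v)
      continuous_id hc (fun t => ((hr.1.1 t).sub (hA₁ t).hasDerivAt).congr_deriv ?_)
      (fun t => by simp only [hr.1.2 t, hA₁per t]) hrA⟩
    simp only [recipRHS]
    ring
  obtain ⟨hpc, hpi⟩ := hint p hp hpA
  obtain ⟨hqc, hqi⟩ := hint q hq hqA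
  have hA₂0 := eq_zero_of_integral_mul_eq_zero hT hA₂ hA₂per hsign
    (g := fun t => B₁ t ^ 2 * ((p t)⁻¹ - (q t)⁻¹))
    ((hB₁.pow 2).mul ((hp.1.1.continuous.inv₀ hp.2.1).sub (hq.1.1.continuous.inv₀ hq.2.1)))
    (fun t => mul_ne_zero (pow_ne_zero 2 (hB₁ne t))
      fun h => hpq t (inv_injective (sub_eq_zero.1 h))) (by
      calc ∫ t in (0 : ℝ)..T, A₂ t * (B₁ t ^ 2 * ((p t)⁻¹ - (q t)⁻¹))
          = ∫ t in (0 : ℝ)..T, ((B₁ t ^ 2 * A₂ t / p t - B₁ t * B₂ t)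
              - (B₁ t ^ 2 * A₂ t / q t - B₁ t * B₂ t)) :=
            intervalIntegral.integral_congr fun t _ => by ring
        _ = 0 := by
            rw [intervalIntegral.integral_sub (hpc.intervalIntegrable _ _)
              (hqc.intervalIntegrable _ _), hpi, hqi, sub_zero])
  refine not_isRecipLimitCycle_of_separable_sub hT (P := fun t => -(B₁ t * B₂ t))
    (F := fun v => v) hA₁ hA₁per continuous_id (fun t r _ => ?_) hpA hp
  simp only [recipRHS, hA₂0]
  ring

/-- If `A₁ A₂` and `B₁ B₂` have opposite constant signs, two disjoint periodic solutions of the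
same sign cannot be isolated. -/
theorem not_two_recipLimitCycles_of_mul_sign (hT : 0 < T) (hA₁ : Differentiable ℝ A₁)
    (hA₂ : Continuous A₂) (hB₁ : Continuous B₁) (hB₂ : Continuous B₂)
    (hA₁per : Function.Periodic A₁ T) (hA₂per : Function.Periodic A₂ T)
    (hB₁per : Function.Periodic B₁ T) (hB₂per : Function.Periodic B₂ T)
    (hB₁ne : ∀ t, B₁ t ≠ 0)
    (hsign : (∀ t, 0 ≤ A₁ t * A₂ t ∧ B₁ t * B₂ t ≤ 0) ∨
      (∀ t, A₁ t * A₂ t ≤ 0 ∧ 0 ≤ B₁ t * B₂ t))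
    (hp : IsRecipLimitCycle T A₁ A₂ B₁ B₂ p) (hq : IsRecipLimitCycle T A₁ A₂ B₁ B₂ q)
    (hpq0 : ∀ t, 0 < p t * q t) (hpq : ∀ t, p t ≠ q t) : False := by
  have hpc := hp.1.1.continuous
  have hqc := hq.1.1.continuous
  have hA₁c := hA₁.continuous
  set α : ℝ → ℝ := fun t => A₁ t * A₂ t * (B₁ t ^ 2 / (p t * q t)) with hα
  have hw : ∀ t, 0 < B₁ t ^ 2 / (p t * q t) := fun t =>
    div_pos (pow_pos (abs_pos.2 (hB₁ne t)) 2 |>.trans_eq (sq_abs _)) (hpq0 t)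
  have hαc : Continuous α := by
    refine Continuous.mul (by fun_prop) (Continuous.div (by fun_prop) (by fun_prop) ?_)
    exact fun t => (hpq0 t).ne'
  have hkc : Continuous fun t => α t - B₁ t * B₂ t := by fun_prop
  have hint := integral_eq_zero_of_periodic (T := T) (y := fun t => q t - p t)
    (F := fun v => v) continuous_id hkc
    (fun t => ((hq.1.1 t).sub (hp.1.1 t)).congr_deriv (by
      have h1 := hp.2.1 t
      have h2 := hq.2.1 t
      simp only [recipRHS, hα]
      field_simp
      ring)) (fun t => by simp only [hp.1.2 t, hq.1.2 t]) fun t => sub_ne_zero.2 (hpq t).symm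
  have hzero : ∀ t, α t - B₁ t * B₂ t = 0 := by
    refine forall_of_forall_Icc_of_periodic hT (fun t => ?_)
      (eq_zero_of_integral_eq_zero hT hkc (hsign.imp (fun h t => ?_) fun h t => ?_) hint)
    · simp only [hα, hA₁per t, hA₂per t, hB₁per t, hB₂per t, hp.1.2 t, hq.1.2 t]
    · linarith [mul_nonneg (h t).1 (hw t).le, (h t).2]
    · linarith [mul_nonpos_of_nonpos_of_nonneg (h t).1 (hw t).le, (h t).2]
  have hBB : ∀ t, B₁ t * B₂ t = 0 := by
    intro t
    have h0 := hzero t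
    rcases hsign with h | h
    · linarith [mul_nonneg (h t).1 (hw t).le, (h t).2]
    · linarith [mul_nonpos_of_nonpos_of_nonneg (h t).1 (hw t).le, (h t).2]
  have hAA : ∀ t, A₁ t * A₂ t = 0 := by
    intro t
    have h0 := hzero t
    rw [hBB, sub_zero] at h0
    exact (mul_eq_zero.1 h0).resolve_right (hw t).ne'
  refine not_isRecipLimitCycle_of_separable_sub hT (A := fun _ => 0)
    (P := fun t => deriv A₁ t + B₁ t ^ 2 * A₂ t) (F := fun _ => 1) (differentiable_const _)
    (fun _ => rfl) continuous_const (fun t r hr => ?_) (fun _ => one_ne_zero) hp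
  simp only [recipRHS, hBB, deriv_const]
  field_simp
  linear_combination -(B₁ t ^ 2) * hAA t

/-- If `A₁` has no zeros and `A₁ B₂ + η A₂ B₁ + A₁' / B₁` has constant sign, two disjoint periodic
solutions cannot be isolated. -/
theorem not_two_recipLimitCycles_of_combination_sign (hT : 0 < T) (hA₁ : Differentiable ℝ A₁)
    (hA₁' : Continuous (deriv A₁)) (hA₂ : Continuous A₂) (hB₁ : Continuous B₁)
    (hB₂ : Continuous B₂) (hA₁per : Function.Periodic A₁ T) (hA₂per : Function.Periodic A₂ T)
    (hB₁per : Function.Periodic B₁ T) (hB₂per : Function.Periodic B₂ T)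
    (hB₁ne : ∀ t, B₁ t ≠ 0) (hA₁ne : ∀ t, A₁ t ≠ 0) {η : ℝ}
    (hsign : (∀ t, 0 ≤ A₁ t * B₂ t + η * A₂ t * B₁ t + deriv A₁ t / B₁ t) ∨
      (∀ t, A₁ t * B₂ t + η * A₂ t * B₁ t + deriv A₁ t / B₁ t ≤ 0))
    (hp : IsRecipLimitCycle T A₁ A₂ B₁ B₂ p) (hq : IsRecipLimitCycle T A₁ A₂ B₁ B₂ q)
    (hpA : ∀ t, p t - A₁ t ≠ 0) (hqA : ∀ t, q t - A₁ t ≠ 0) (hpq : ∀ t, p t ≠ q t) : False := by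
  have hA₁c := hA₁.continuous
  set P : ℝ → ℝ := fun t => B₁ t ^ 2 * A₂ t / A₁ t with hPdef
  set R : ℝ → ℝ := fun t => B₁ t * B₂ t + deriv A₁ t / A₁ t + η * P t with hRdef
  have hPc : Continuous P := Continuous.div (by fun_prop) hA₁c hA₁ne
  have hRc : Continuous R :=
    ((hB₁.mul hB₂).add (hA₁'.div hA₁c hA₁ne)).add (continuous_const.mul hPc)
  have hRper : Function.Periodic R T := fun t => by
    simp only [hRdef, hPdef, hA₁per t, hA₂per t, hB₁per t, hB₂per t, hA₁per.deriv_real t]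
  have hRsign : (∀ t, 0 ≤ R t) ∨ (∀ t, R t ≤ 0) := by
    have hR : ∀ t, (A₁ t * B₂ t + η * A₂ t * B₁ t + deriv A₁ t / B₁ t) * (B₁ t / A₁ t) = R t := by
      intro t
      have h1 := hA₁ne t
      have h2 := hB₁ne t
      simp only [hRdef, hPdef]
      field_simp
      ring
    simpa only [Pi.div_apply, hR] using mul_sign_of_ne_zero hsign (hB₁.div hA₁c hA₁ne)
      fun t => div_ne_zero (hB₁ne t) (hA₁ne t)
  have hdiv : ∀ r : ℝ → ℝ, IsRecipLimitCycle T A₁ A₂ B₁ B₂ r → (∀ t, r t - A₁ t ≠ 0) →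
      IsPeriodicSolution (fun t y => y * (y - 1) * (P t * (y + η) - R t)) T
        (fun t => A₁ t / r t) ∧ (∀ t, A₁ t / r t ≠ 0) ∧ ∀ t, A₁ t / r t - 1 ≠ 0 := by
    intro r hr hrA
    refine ⟨hr.1.div_recip hA₁ hA₁per hA₁ne (fun _ => rfl) (fun _ => rfl) hr.2.1,
      fun t => div_ne_zero (hA₁ne t) (hr.2.1 t), fun t h => hrA t ?_⟩
    rw [sub_eq_zero, div_eq_one_iff_eq (hr.2.1 t)] at h
    rw [h, sub_self]
  obtain ⟨hyp, hy0, hy1⟩ := hdiv p hp hpA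
  obtain ⟨hzp, hz0, hz1⟩ := hdiv q hq hqA
  have hyz : ∀ t, A₁ t / p t ≠ A₁ t / q t := fun t h =>
    hpq t (by
      rw [← div_div_cancel₀ (hA₁ne t) (b := p t), h, div_div_cancel₀ (hA₁ne t)])
  have hR0 := eq_zero_of_two_periodic hT hPc hRc hRper hRsign hyp hzp hy0 hy1 hz0 hz1 hyz
  have hconst : ∀ r : ℝ → ℝ, IsRecipLimitCycle T A₁ A₂ B₁ B₂ r → (∀ t, r t - A₁ t ≠ 0) →
      ∀ t, A₁ t / r t + η = 0 := by
    intro r hr hrA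
    obtain ⟨hw, -, hw1⟩ := hdiv r hr hrA
    have hwc := hw.1.continuous
    by_contra hne
    refine not_isRecipLimitCycle_of_separable_div hT hA₁ hA₁per hA₁ne (P := P) (η := η)
      (fun _ => rfl) hR0 hw1 (fun a ha => hne fun t => ?_) hr
    exact eq_zero_of_hasDerivAt_mul (f := fun t => A₁ t / r t + η)
      (K := fun t => A₁ t / r t * (A₁ t / r t - 1) * P t) (by fun_prop)
      (fun t => ((hw.1 t).add_const η).congr_deriv (by simp only [hR0]; ring)) ha t
  exact hyz 0 (by linarith [hconst p hp hpA 0, hconst q hq hqA 0])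

end Criteria

/-- **Proposition (Huang–Liang–Llibre).** Equation (‡) has at most one limit cycle
(counted with multiplicity) with graph included in `V` if one of the following holds:
(i) `A₁(t) ≠ 0` for all `t` and there exists `η ∈ ℝ` such that
`A₁ B₂ + η A₂ B₁ + A₁'/B₁` is `≥ 0` on `[0,T]` (or `≤ 0` on `[0,T]`);
(ii) `A₂ ≥ 0` on `[0,T]` (or `A₂ ≤ 0` on `[0,T]`);
(iii) either `A₁A₂ ≥ 0` and `B₁B₂ ≤ 0` on `[0,T]`, or `A₁A₂ ≤ 0` and `B₁B₂ ≥ 0`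
on `[0,T]`. -/
theorem hl_at_most_one_limit_cycle
    (T : ℝ) (hT : 0 < T) (A₁ A₂ B₁ B₂ : ℝ → ℝ)
    (hA₁ : ContDiff ℝ (⊤ : ℕ∞) A₁) (hA₂ : ContDiff ℝ (⊤ : ℕ∞) A₂)
    (hB₁ : ContDiff ℝ (⊤ : ℕ∞) B₁) (hB₂ : ContDiff ℝ (⊤ : ℕ∞) B₂)
    (hA₁per : Function.Periodic A₁ T) (hA₂per : Function.Periodic A₂ T)
    (hB₁per : Function.Periodic B₁ T) (hB₂per : Function.Periodic B₂ T)
    (hB₁ne : ∀ t, B₁ t ≠ 0)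
    (hcond :
      ((∀ t ∈ Icc (0 : ℝ) T, A₁ t ≠ 0) ∧ ∃ η : ℝ,
        (∀ t ∈ Icc (0 : ℝ) T,
          0 ≤ A₁ t * B₂ t + η * A₂ t * B₁ t + deriv A₁ t / B₁ t) ∨
        (∀ t ∈ Icc (0 : ℝ) T,
          A₁ t * B₂ t + η * A₂ t * B₁ t + deriv A₁ t / B₁ t ≤ 0)) ∨
      ((∀ t ∈ Icc (0 : ℝ) T, 0 ≤ A₂ t) ∨ (∀ t ∈ Icc (0 : ℝ) T, A₂ t ≤ 0)) ∨
      ((∀ t ∈ Icc (0 : ℝ) T, 0 ≤ A₁ t * A₂ t ∧ B₁ t * B₂ t ≤ 0) ∨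
       (∀ t ∈ Icc (0 : ℝ) T, A₁ t * A₂ t ≤ 0 ∧ 0 ≤ B₁ t * B₂ t))) :
    ∀ x y : ℝ → ℝ,
      IsLimitCycle (hlRHS A₁ A₂ B₁ B₂) T x →
        (∀ t, (t, x t) ∈ regionV fun t => A₁ t / B₁ t) →
      IsLimitCycle (hlRHS A₁ A₂ B₁ B₂) T y →
        (∀ t, (t, y t) ∈ regionV fun t => A₁ t / B₁ t) →
      x = y := by
  intro x y hx hxV hy hyV
  by_contra hxy
  have hA₁d : Differentiable ℝ A₁ := hA₁.differentiable (by simp)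
  have hB₁d : Differentiable ℝ B₁ := hB₁.differentiable (by simp)
  have hA₁' : Continuous (deriv A₁) := hA₁.continuous_deriv (by simp)
  have hB₁' : Continuous (deriv B₁) := hB₁.continuous_deriv (by simp)
  have hA₁c := hA₁.continuous
  have hA₂c := hA₂.continuous
  have hB₁c := hB₁.continuous
  have hB₂c := hB₂.continuous
  have hne := ne_of_periodicSolution_of_ne hA₁c hA₂c hB₁c hB₂c hA₁' hB₁' hB₁ne hx.1 hy.1 hxy
  obtain ⟨hx0, hxpos⟩ := ne_zero_and_lt_inv_of_mem_regionV hxV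
  obtain ⟨hy0, hypos⟩ := ne_zero_and_lt_inv_of_mem_regionV hyV
  have hp := hx.recip hB₁d hB₁per hB₁ne fun t => (hx0 t).1
  have hq := hy.recip hB₁d hB₁per hB₁ne fun t => (hy0 t).1
  have hsub : ∀ z : ℝ → ℝ, (∀ t, z t ≠ 0 ∧ A₁ t / B₁ t < 1 / z t) →
      ∀ t, B₁ t / z t - A₁ t ≠ 0 := by
    intro z hz t h
    refine (hz t).2.ne ?_
    rw [← sub_eq_zero.1 h, div_right_comm, div_self (hB₁ne t)]
  have hpq : ∀ t, B₁ t / x t ≠ B₁ t / y t := fun t h =>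
    hne t (by
      rw [← div_div_cancel₀ (hB₁ne t) (b := x t), h, div_div_cancel₀ (hB₁ne t)])
  have hA₂sign : (∀ t, 0 ≤ A₂ t) ∨ (∀ t, A₂ t ≤ 0) → False := fun h =>
    not_two_recipLimitCycles_of_sign hT hA₁d hA₂c hB₁c hB₂c hA₁per hA₂per hB₁ne h hp hq
      (hsub x hx0) (hsub y hy0) hpq
  rcases hcond with ⟨hA₁ne, η, hη⟩ | hA₂s | hs
  · refine not_two_recipLimitCycles_of_combination_sign hT hA₁d hA₁' hA₂c hB₁c hB₂c hA₁per hA₂per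
      hB₁per hB₂per hB₁ne
      (forall_of_forall_Icc_of_periodic hT (fun t => by simp only [hA₁per t]) hA₁ne) (η := η)
      (hη.imp (forall_of_forall_Icc_of_periodic hT fun t => ?_)
        (forall_of_forall_Icc_of_periodic hT fun t => ?_)) hp hq (hsub x hx0) (hsub y hy0) hpq
    all_goals simp only [hA₁per t, hA₂per t, hB₁per t, hB₂per t, hA₁per.deriv_real t]
  · refine hA₂sign (hA₂s.imp (forall_of_forall_Icc_of_periodic hT fun t => ?_)
      (forall_of_forall_Icc_of_periodic hT fun t => ?_))
    all_goals simp only [hA₂per t]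
  · have hs' : (∀ t, 0 ≤ A₁ t * A₂ t ∧ B₁ t * B₂ t ≤ 0) ∨
        (∀ t, A₁ t * A₂ t ≤ 0 ∧ 0 ≤ B₁ t * B₂ t) := by
      refine hs.imp (forall_of_forall_Icc_of_periodic hT fun t => ?_)
        (forall_of_forall_Icc_of_periodic hT fun t => ?_)
      all_goals simp only [hA₁per t, hA₂per t, hB₁per t, hB₂per t]
    by_cases hA₁z : ∃ t, A₁ t = 0
    · obtain ⟨s, hs0⟩ := hA₁z
      have hz : ∃ t, A₁ t / B₁ t = 0 := ⟨s, by rw [hs0, zero_div]⟩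
      refine not_two_recipLimitCycles_of_mul_sign hT hA₁d hA₂c hB₁c hB₂c hA₁per hA₂per hB₁per
        hB₂per hB₁ne hs' hp hq (fun t => ?_) hpq
      rw [div_mul_div_comm]
      exact div_pos (mul_self_pos.2 (hB₁ne t)) (mul_pos (hxpos hz t) (hypos hz t))
    · push Not at hA₁z
      have h1 : (∀ t, 0 ≤ A₁ t * A₂ t) ∨ (∀ t, A₁ t * A₂ t ≤ 0) :=
        hs'.imp (fun h t => (h t).1) fun h t => (h t).1
      have h2 := mul_sign_of_ne_zero h1 (hA₁c.inv₀ hA₁z) fun t => inv_ne_zero (hA₁z t)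
      have h3 : ∀ t, A₁ t * A₂ t * (A₁ t)⁻¹ = A₂ t := fun t => by
        rw [mul_right_comm, mul_inv_cancel₀ (hA₁z t), one_mul]
      exact hA₂sign (by simpa only [Pi.inv_apply, h3] using h2)
end

section
/- Assume that a₂ has definite sign on [0,T] (that is, a₂(t) ≥ 0 for all t ∈ [0,T], or a₂(t) ≤ 0 for all t ∈ [0,T]), with the inequality strict for all t in some subset of [0,T] of positive Lebesgue measure. Then equation (★) has at most one non-trivial limit cycle with graph included in V. -/
open MeasureTheory Real Set

/-- Right-hand side of the Abel equation (★):
`x' = a₁ a₂ x³ − (a₁ b₂ + a₂) x² + (b₂ − a₁'/a₁) x`. -/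
noncomputable def abelRHS (a₁ a₂ b₂ : ℝ → ℝ) (t x : ℝ) : ℝ :=
  a₁ t * a₂ t * x ^ 3 - (a₁ t * b₂ t + a₂ t) * x ^ 2 +
    (b₂ t - deriv a₁ t / a₁ t) * x

open Filter Topology in
/-- A derivative that is nonnegative immediately to the right of a point is nonnegative at it. -/
lemma deriv_nonneg_of_eventually_nhdsGT {g : ℝ → ℝ} {c : ℝ} (hg : Differentiable ℝ g)
    (h : ∀ᶠ t in 𝓝[>] c, 0 ≤ deriv g t) : 0 ≤ deriv g c := by
  obtain ⟨d, hd, hI⟩ := mem_nhdsGT_iff_exists_Ioo_subset.1 h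
  have hmono : MonotoneOn g (Ico c d) := by
    refine monotoneOn_of_deriv_nonneg (convex_Ico c d) hg.continuous.continuousOn
      hg.differentiableOn ?_
    intro t ht
    rw [interior_Ico] at ht
    exact hI ht
  have hlim := (hasDerivAt_iff_tendsto_slope.1 (hg c).hasDerivAt).mono_left
    (nhdsWithin_mono c (fun t (ht : t ∈ Ioi c) => ne_of_gt ht))
  refine ge_of_tendsto hlim ?_
  filter_upwards [Ioo_mem_nhdsGT hd] with t ht
  rw [slope_def_field]
  exact div_nonneg (sub_nonneg.2 (hmono (left_mem_Ico.2 hd) ⟨ht.1.le, ht.2⟩ ht.1.le))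
    (sub_nonneg.2 ht.1.le)

open Filter Topology in
/-- The simple zeros of a real function form a countable set. -/
lemma countable_setOf_eq_zero_deriv_ne_zero (f : ℝ → ℝ) :
    {t | f t = 0 ∧ deriv f t ≠ 0}.Countable := by
  refine (HereditarilyLindelofSpace.isLindelof _).countable
    (discreteTopology_subtype_iff.2 fun t ht => ?_)
  have h := (differentiableAt_of_deriv_ne_zero ht.2).hasDerivAt.eventually_ne (c := 0) ht.2
  rw [← Filter.empty_mem_iff_bot, Filter.mem_inf_principal]
  filter_upwards [h] with r hr hrS using hr hrS.1

/-- A monotone periodic function is constant. -/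
lemma Monotone.eq_of_periodic {g : ℝ → ℝ} {T : ℝ} (hg : Monotone g) (hT : 0 < T)
    (hper : Function.Periodic g T) (s t : ℝ) : g s = g t := by
  have key : ∀ s t, g s ≤ g t := fun s t => by
    obtain ⟨n, hn⟩ := exists_nat_ge ((s - t) / T)
    rw [div_le_iff₀ hT] at hn
    calc g s ≤ g (t + n * T) := hg (by linarith)
      _ = g t := hper.nat_mul n t
  exact le_antisymm (key s t) (key t s)

/-- On `V` the quantity `x (1 - a₁ x)` is positive. -/
lemma mul_one_sub_pos_of_mem_regionV {a₁ : ℝ → ℝ} {t x : ℝ} (h : (t, x) ∈ regionV a₁) :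
    0 < x * (1 - a₁ t * x) := by
  have pos_case : 0 < x → (0 < a₁ t → x < 1 / a₁ t) → 0 < x * (1 - a₁ t * x) := by
    intro hx hxa
    refine mul_pos hx (sub_pos.2 ?_)
    rcases le_or_gt (a₁ t) 0 with ha | ha
    · nlinarith
    · have := (lt_div_iff₀ ha).1 (hxa ha)
      linarith
  unfold regionV at h
  split_ifs at h with h₁ h₂
  · exact pos_case h.1 fun _ => h.2
  · rcases h with h | h
    · exact pos_case h fun ha => absurd ha (h₂ t).not_gt
    · have ha := h₂ t
      have h' : 1 < x * a₁ t := (lt_div_iff_of_neg ha).1 h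
      have hx : x < 0 := by nlinarith
      exact mul_pos_of_neg_of_neg hx (by linarith)
  · exact pos_case h.1 h.2

/-- Along a solution of (★), the logarithm of `x / (1 - a₁ x)` has derivative
`b₂ - a₂ x - a₁' / a₁` away from the zeros of `a₁`; at these zeros the convention `u / 0 = 0`
produces the extra term `a₁' x`. -/
lemma hasDerivAt_log_sub_log_of_isSolution {a₁ a₂ b₂ x : ℝ → ℝ} (ha₁ : Differentiable ℝ a₁)
    (hx : IsSolution (abelRHS a₁ a₂ b₂) x) (hV : ∀ t, 0 < x t * (1 - a₁ t * x t)) (t : ℝ) :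
    HasDerivAt (fun s => log (x s) - log (1 - a₁ s * x s))
      (b₂ t - a₂ t * x t - deriv a₁ t / a₁ t + if a₁ t = 0 then deriv a₁ t * x t else 0) t := by
  have hx0 : x t ≠ 0 := left_ne_zero_of_mul (hV t).ne'
  have hz0 : 1 - a₁ t * x t ≠ 0 := right_ne_zero_of_mul (hV t).ne'
  have h := ((hx t).log hx0).sub (((((ha₁ t).hasDerivAt).mul (hx t)).const_sub 1).log hz0)
  refine h.congr_deriv ?_
  simp only [abelRHS]
  split_ifs with ha
  · simp only [Pi.mul_apply, ha, zero_mul, sub_zero]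
    field_simp
    ring
  · simp only [Pi.mul_apply]
    field_simp
    ring

/-- **Proposition 3 (definite-sign criterion).** If `a₂` has definite sign on `[0,T]`
(encoded by `σ = 1` for `a₂ ≥ 0`, `σ = -1` for `a₂ ≤ 0`), strict on a subset of
positive measure, then equation (★) has at most one non-trivial limit cycle with
graph included in `V`. -/
theorem abel_definite_sign_at_most_one_limit_cycle
    (T : ℝ) (hT : 0 < T) (a₁ a₂ b₂ : ℝ → ℝ)
    (ha₁smooth : ContDiff ℝ (⊤ : ℕ∞) a₁) (ha₁per : Function.Periodic a₁ T)
    (ha₁ne : ∃ t, a₁ t ≠ 0)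
    (ha₂per : Function.Periodic a₂ T) (hb₂per : Function.Periodic b₂ T)
    (ha₂smooth : ContDiffOn ℝ (⊤ : ℕ∞) a₂ {t | a₁ t ≠ 0})
    (hb₂smooth : ContDiffOn ℝ (⊤ : ℕ∞) b₂ {t | a₁ t ≠ 0})
    (ha₂int : IntervalIntegrable a₂ volume 0 T)
    (hb₂int : IntervalIntegrable b₂ volume 0 T)
    (σ : ℝ) (hσ : σ = 1 ∨ σ = -1)
    (hsign : ∀ t ∈ Icc (0 : ℝ) T, 0 ≤ σ * a₂ t)
    (P : Set ℝ) (hP : P ⊆ Icc (0 : ℝ) T) (hPpos : 0 < volume P)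
    (hPstrict : ∀ t ∈ P, 0 < σ * a₂ t) :
    ∀ x y : ℝ → ℝ,
      IsLimitCycle (abelRHS a₁ a₂ b₂) T x → (∀ t, (t, x t) ∈ regionV a₁) →
        (∃ t, x t ≠ 0) →
      IsLimitCycle (abelRHS a₁ a₂ b₂) T y → (∀ t, (t, y t) ∈ regionV a₁) →
        (∃ t, y t ≠ 0) →
      x = y := by
  intro x y hx hxV _ hy hyV _
  have ha₁ : Differentiable ℝ a₁ := ha₁smooth.differentiable (by simp)
  have hxp := fun t => mul_one_sub_pos_of_mem_regionV (hxV t)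
  have hyp := fun t => mul_one_sub_pos_of_mem_regionV (hyV t)
  have hxc : Continuous x := continuous_iff_continuousAt.2 fun t => (hx.1.1 t).continuousAt
  have hyc : Continuous y := continuous_iff_continuousAt.2 fun t => (hy.1.1 t).continuousAt
  set D : ℝ → ℝ := fun t => y t * (1 - a₁ t * x t) with hD
  set R : ℝ → ℝ := fun t => x t * (1 - a₁ t * y t) / D t with hR
  have hD0 : ∀ t, D t ≠ 0 := fun t =>
    mul_ne_zero (left_ne_zero_of_mul (hyp t).ne') (right_ne_zero_of_mul (hxp t).ne')
  have hRpos : ∀ t, 0 < R t := fun t => by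
    have h : R t = x t * (1 - a₁ t * x t) * (y t * (1 - a₁ t * y t)) / D t ^ 2 := by
      have := hD0 t
      simp only [hR]
      field_simp
      simp only [hD]
      ring
    rw [h]
    exact div_pos (mul_pos (hxp t) (hyp t)) (by have := hD0 t; positivity)
  have hRD : ∀ t, x t - y t = D t * (R t - 1) := fun t => by
    rw [mul_sub, hR, mul_div_cancel₀ _ (hD0 t)]
    simp only [hD]
    ring
  have hlogR : ∀ t, log (R t) = (log (x t) - log (1 - a₁ t * x t)) -
      (log (y t) - log (1 - a₁ t * y t)) := fun t => by
    have h₁ := left_ne_zero_of_mul (hxp t).ne'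
    have h₂ := right_ne_zero_of_mul (hxp t).ne'
    have h₃ := left_ne_zero_of_mul (hyp t).ne'
    have h₄ := right_ne_zero_of_mul (hyp t).ne'
    simp only [hR, hD]
    rw [log_div (mul_ne_zero h₁ h₄) (mul_ne_zero h₃ h₂), log_mul h₁ h₄, log_mul h₃ h₂]
    ring
  have hLderiv : ∀ t, HasDerivAt (fun s => log (R s))
      (-(a₂ t - if a₁ t = 0 then deriv a₁ t else 0) * (x t - y t)) t := fun t => by
    rw [funext hlogR]
    refine ((hasDerivAt_log_sub_log_of_isSolution ha₁ hx.1.1 hxp t).sub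
      (hasDerivAt_log_sub_log_of_isSolution ha₁ hy.1.1 hyp t)).congr_deriv ?_
    split_ifs <;> ring
  have hDsign : ∃ s : ℝ, ∀ t, 0 < s * D t := by
    have hDc : Continuous D := by fun_prop
    refine ⟨D 0, fun t => ?_⟩
    by_contra! hneg
    have hmem : (0 : ℝ) ∈ (fun r => D 0 * D r) '' univ :=
      isPreconnected_univ.intermediate_value (mem_univ t) (mem_univ 0)
        (by fun_prop) ⟨hneg, mul_self_nonneg _⟩
    obtain ⟨r, -, hr⟩ := hmem
    exact mul_ne_zero (hD0 0) (hD0 r) hr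
  obtain ⟨s, hs⟩ := hDsign
  have hsign' : ∀ t, 0 ≤ σ * a₂ t := fun t => by
    obtain ⟨r, hr, hrt⟩ := ha₂per.exists_mem_Ico₀ hT t
    rw [hrt]
    exact hsign r ⟨hr.1, hr.2.le⟩
  have hq : ∀ t, 0 ≤ (R t - 1) * log (R t) := fun t => by
    rcases le_total 1 (R t) with h | h
    · exact mul_nonneg (sub_nonneg.2 h) (log_nonneg h)
    · exact mul_nonneg_of_nonpos_of_nonpos (sub_nonpos.2 h) (log_nonpos (hRpos t).le h)
  set G : ℝ → ℝ := fun t => -(σ * s) * log (R t) ^ 2 with hG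
  set E : Set ℝ := {t | a₁ t = 0 ∧ deriv a₁ t ≠ 0} with hE
  have hGdiff : Differentiable ℝ G := fun t =>
    (((hLderiv t).pow 2).const_mul (-(σ * s))).differentiableAt
  have hGderiv : ∀ t, t ∉ E →
      deriv G t = 2 * (σ * a₂ t) * (s * D t) * ((R t - 1) * log (R t)) := fun t ht => by
    have he : (if a₁ t = 0 then deriv a₁ t else 0) = 0 := by
      split_ifs with h
      · by_contra h'
        exact ht ⟨h, h'⟩
      · rfl
    have h := (((hLderiv t).pow 2).const_mul (-(σ * s))).deriv
    rw [he, hRD] at h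
    refine h.trans ?_
    push_cast
    ring
  have hGnonneg : ∀ t, t ∉ E → 0 ≤ deriv G t := fun t ht => by
    rw [hGderiv t ht]
    exact mul_nonneg (mul_nonneg (mul_nonneg zero_le_two (hsign' t)) (hs t).le) (hq t)
  have hGmono : Monotone G := by
    refine monotone_of_deriv_nonneg hGdiff fun t => ?_
    by_cases ht : t ∈ E
    · refine deriv_nonneg_of_eventually_nhdsGT hGdiff ?_
      have h := (ha₁ t).hasDerivAt.eventually_ne (c := 0) ht.2
      filter_upwards [h.filter_mono (nhdsWithin_mono t fun r (hr : t < r) => hr.ne')] with r hr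
      exact hGnonneg r fun hrE => hr hrE.1
    · exact hGnonneg t ht
  have hGper : Function.Periodic G T := fun t => by
    simp only [hG, hR, hD, ha₁per t, hx.1.2 t, hy.1.2 t]
  have hGconst := fun t r => hGmono.eq_of_periodic hT hGper t r
  obtain ⟨p, hpP, hpE⟩ : ∃ p ∈ P, p ∉ E := by
    by_contra! h
    exact hPpos.ne' (((countable_setOf_eq_zero_deriv_ne_zero a₁).mono h).measure_zero volume)
  have hxy : ∀ t, R t = 1 → x t = y t := fun t ht => by
    have := hRD t
    rw [ht] at this
    linarith
  have hp : log (R p) = 0 := by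
    have h0 : deriv G p = 0 := by
      rw [show G = fun _ => G 0 from funext fun t => hGconst t 0, deriv_const]
    rw [hGderiv p hpE] at h0
    have hpos : 0 < 2 * (σ * a₂ p) * (s * D p) :=
      mul_pos (mul_pos two_pos (hPstrict p hpP)) (hs p)
    rcases mul_eq_zero.1 ((mul_eq_zero.1 h0).resolve_left hpos.ne') with h | h
    · rw [sub_eq_zero.1 h, log_one]
    · exact h
  have hσs : -(σ * s) ≠ 0 := by
    refine neg_ne_zero.2 (mul_ne_zero ?_ (left_ne_zero_of_mul (hs 0).ne'))
    exact left_ne_zero_of_mul (hPstrict p hpP).ne'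
  funext t
  refine hxy t (eq_one_of_pos_of_log_eq_zero (hRpos t) ?_)
  have h := hGconst t p
  simp only [hG, hp] at h
  simpa [hσs, neg_ne_zero.1 hσs] using h
end

section
/- Let q(t,x) = 0 be a periodic algebraic invariant curve of x' = p(t,x) with cofactor Q(t,x), i.e. q_t(t,x) + q_x(t,x)p(t,x) = q(t,x)Q(t,x), and assume the set of t at which the coefficients of Q (as a polynomial in x) have poles has Lebesgue measure zero. If u(t,x) is a periodic solution such that q(t, u(t,x)) ≠ 0 for all t ∈ [0,T], then ∫₀ᵀ Q(t, u(t,x)) dt = 0. -/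
open Real Set MeasureTheory

/-- **Vanishing of the integral of the cofactor along a periodic solution.**
Let `q(t,x) = 0` be a periodic algebraic invariant curve of `x' = p(t,x)` (so `q` is
a polynomial in `x` with smooth `T`-periodic coefficients `c i`) with cofactor
`Q(t,x)` (a polynomial in `x`, `T`-periodic in `t`, whose coefficients may have
poles on a set `N` of times of Lebesgue measure zero), i.e.
`q_t(t,x) + q_x(t,x) p(t,x) = q(t,x) Q(t,x)` for `t ∉ N`.
If `u` is a periodic solution with `q(t, u(t)) ≠ 0` for all `t ∈ [0,T]`, then
`∫₀ᵀ Q(t, u(t)) dt = 0`. -/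
theorem integral_cofactor_eq_zero
    (T : ℝ) (hT : 0 < T) (p : ℝ → ℝ → ℝ)
    (hp : ContDiff ℝ (⊤ : ℕ∞) fun s : ℝ × ℝ => p s.1 s.2)
    (hpper : ∀ t x, p (t + T) x = p t x)
    (m : ℕ) (c : ℕ → ℝ → ℝ)
    (hc : ∀ i, ContDiff ℝ (⊤ : ℕ∞) (c i))
    (hcper : ∀ i, Function.Periodic (c i) T)
    (q : ℝ → ℝ → ℝ)
    (hq : ∀ t x, q t x = ∑ i ∈ Finset.range (m + 1), c i t * x ^ i)
    (mQ : ℕ) (cQ : ℕ → ℝ → ℝ) (Q : ℝ → ℝ → ℝ)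
    (hQ : ∀ t x, Q t x = ∑ i ∈ Finset.range (mQ + 1), cQ i t * x ^ i)
    (hQper : ∀ t x, Q (t + T) x = Q t x)
    (N : Set ℝ) (hN : volume N = 0)
    (hcof : ∀ t ∉ N, ∀ x,
      deriv (fun s => q s x) t + deriv (fun y => q t y) x * p t x = q t x * Q t x)
    (u : ℝ → ℝ) (hu : ∀ t, HasDerivAt u (p t (u t)) t)
    (huper : Function.Periodic u T)
    (hqne : ∀ t ∈ Icc (0 : ℝ) T, q t (u t) ≠ 0)
    (hQint : IntervalIntegrable (fun t => Q t (u t)) volume 0 T) :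
    ∫ t in (0 : ℝ)..T, Q t (u t) = 0 := by
  have huc : Continuous u := continuous_iff_continuousAt.2 fun t => (hu t).continuousAt
  have hpu : Continuous fun t => p t (u t) := hp.continuous.comp (continuous_id.prodMk huc)
  have hcd : ∀ i t, HasDerivAt (c i) (deriv (c i) t) t := fun i t =>
    ((hc i).differentiable (by simp) t).hasDerivAt
  have hcdc : ∀ i, Continuous (deriv (c i)) := fun i => (hc i).continuous_deriv (by simp)
  have hcc : ∀ i, Continuous (c i) := fun i => (hc i).continuous
  have hqt : ∀ t x, deriv (fun s => q s x) t =
      ∑ i ∈ Finset.range (m + 1), deriv (c i) t * x ^ i := by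
    intro t x
    simp only [hq]
    exact (HasDerivAt.fun_sum fun i _ => (hcd i t).mul_const (x ^ i)).deriv
  have hqx : ∀ t x, deriv (fun y => q t y) x =
      ∑ i ∈ Finset.range (m + 1), c i t * (i * x ^ (i - 1)) := by
    intro t x
    simp only [hq]
    exact (HasDerivAt.fun_sum fun i _ => (hasDerivAt_pow i x).const_mul (c i t)).deriv
  set D : ℝ → ℝ := fun t => ∑ i ∈ Finset.range (m + 1), deriv (c i) t * u t ^ i +
    (∑ i ∈ Finset.range (m + 1), c i t * (i * u t ^ (i - 1))) * p t (u t) with hD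
  have hDc : Continuous D := by
    refine (continuous_finsetSum _ fun i _ => (hcdc i).mul (huc.pow i)).add
      ((continuous_finsetSum _ fun i _ => ?_).mul hpu)
    exact (hcc i).mul (continuous_const.mul (huc.pow _))
  have hF : ∀ t, HasDerivAt (fun s => q s (u s)) (D t) t := by
    intro t
    simp only [hq, hD]
    refine (HasDerivAt.fun_sum fun i _ => (hcd i t).mul ((hu t).pow i)).congr_deriv ?_
    rw [Finset.sum_mul, ← Finset.sum_add_distrib]
    refine Finset.sum_congr rfl fun i _ => ?_
    simp only [Pi.pow_apply]
    ring
  have hFc : Continuous fun s => q s (u s) :=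
    continuous_iff_continuousAt.2 fun t => (hF t).continuousAt
  have hIcc : uIcc (0 : ℝ) T = Icc 0 T := uIcc_of_le hT.le
  have hae : ∫ t in (0 : ℝ)..T, Q t (u t) = ∫ t in (0 : ℝ)..T, D t / q t (u t) := by
    refine intervalIntegral.integral_congr_ae ?_
    have hN' : ∀ᵐ t ∂(volume : Measure ℝ), t ∉ N := measure_eq_zero_iff_ae_notMem.1 hN
    filter_upwards [hN'] with t ht htT
    have hne := hqne t (hIcc ▸ uIoc_subset_uIcc htT)
    have h := hcof t ht (u t)
    rw [hqt, hqx] at h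
    rw [eq_div_iff hne, mul_comm]
    exact h.symm
  rw [hae, intervalIntegral.integral_eq_sub_of_hasDerivAt
    (f := fun t => Real.log (q t (u t)))
    (fun t ht => (hF t).log (hqne t (hIcc ▸ ht)))
    (hDc.continuousOn.div hFc.continuousOn fun t ht => hqne t (hIcc ▸ ht)).intervalIntegrable]
  have huT : u T = u 0 := by simpa using huper 0
  have hqT : q T (u T) = q 0 (u 0) := by
    rw [huT, hq, hq]
    refine Finset.sum_congr rfl fun i _ => ?_
    have h : c i T = c i 0 := by simpa using hcper i 0
    rw [h]
  simp only [hqT, sub_self]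
end

section
/- Assume a > 0 and that for each θ ∈ [0,2π]: (i) if ψ(θ) < 0 then aψ(θ) − φ(θ) ≤ 0; (ii) if ψ(θ) > 0 then φ(θ) ≥ 0; with the inequalities in (i) and (ii) strict for every θ in some subset of [0,2π] of positive Lebesgue measure. Then the equation dr/dθ = (ar + φ(θ)rⁿ)/(1 + ψ(θ)r^{n−1}) has no positive 2π-periodic limit cycle satisfying 1 + ψ(θ)r(θ)^{n−1} > 0 for all θ; equivalently, the planar system has no limit cycle surrounding the origin. The same conclusion holds when a < 0 with the inequality signs in (i) and (ii) reversed. -/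
open Real Set MeasureTheory

/-- Right-hand side of the polar equation `dr/dθ = (a r + φ(θ) rⁿ)/(1 + ψ(θ) r^{n−1})`. -/
noncomputable def polarRHS (a : ℝ) (φ ψ : ℝ → ℝ) (n : ℕ) (θ r : ℝ) : ℝ :=
  (a * r + φ θ * r ^ n) / (1 + ψ θ * r ^ (n - 1))

open scoped Topology

/-- A function which is nonnegative on a punctured neighbourhood of `x` and continuous at `x`
is nonnegative at `x`. -/
theorem nonneg_of_eventually_nhdsNE {f : ℝ → ℝ} {x : ℝ} (hf : ContinuousAt f x)
    (h : ∀ᶠ y in 𝓝[≠] x, 0 ≤ f y) : 0 ≤ f x :=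
  ge_of_tendsto (hf.mono_left nhdsWithin_le_nhds) h

/-- A differentiable function with equal values at the endpoints of an interval has a zero
derivative throughout the interior if its derivative is nonnegative there. -/
theorem deriv_eq_zero_of_nonneg_of_eq {g g' : ℝ → ℝ} {b c : ℝ}
    (hg : ∀ t, HasDerivAt g (g' t) t) (hnn : ∀ t ∈ Ioo b c, 0 ≤ g' t) (hbc : g b = g c) :
    ∀ t ∈ Ioo b c, g' t = 0 := by
  intro t ht
  have hle : b ≤ c := (ht.1.trans ht.2).le
  have hmono : MonotoneOn g (Icc b c) := by
    refine monotoneOn_of_deriv_nonneg (convex_Icc b c)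
      (fun s _ => (hg s).continuousAt.continuousWithinAt)
      (fun s _ => (hg s).differentiableAt.differentiableWithinAt) ?_
    intro s hs
    rw [interior_Icc] at hs
    rw [(hg s).deriv]
    exact hnn s hs
  have hconst : g =ᶠ[𝓝 t] fun _ => g b := by
    filter_upwards [Icc_mem_nhds ht.1 ht.2] with s hs
    exact le_antisymm ((hmono hs (right_mem_Icc.2 hle) hs.2).trans_eq hbc.symm)
      (hmono (left_mem_Icc.2 hle) hs hs.1)
  exact (hg t).unique ((hasDerivAt_const t (g b)).congr_of_eventuallyEq hconst)

/-- Evaluating a bivariate polynomial along the unit circle gives an analytic function. -/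
theorem analyticAt_eval_cos_sin (p : MvPolynomial (Fin 2) ℝ) (θ : ℝ) :
    AnalyticAt ℝ (fun θ => MvPolynomial.eval ![cos θ, sin θ] p) θ := by
  refine AnalyticAt.aeval_mvPolynomial (f := fun θ => ![cos θ, sin θ]) (fun i => ?_) p
  fin_cases i
  · exact analyticAt_cos
  · exact analyticAt_sin

/-- Where `ψ` does not vanish, `σ` times the polar right-hand side is positive. -/
theorem polarRHS_mul_pos {a σ r θ : ℝ} {φ ψ : ℝ → ℝ} {n : ℕ} (hn : 1 ≤ n)
    (ha : 0 < σ * a) (hr : 0 < r) (hD : 0 < 1 + ψ θ * r ^ (n - 1))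
    (hi : ψ θ < 0 → σ * (a * ψ θ - φ θ) ≤ 0) (hii : 0 < ψ θ → 0 ≤ σ * φ θ)
    (hne : ψ θ ≠ 0) : 0 < σ * polarRHS a φ ψ n θ r := by
  obtain ⟨m, rfl⟩ := Nat.exists_eq_add_of_le' hn
  simp only [Nat.add_sub_cancel] at hD
  have hk : 0 < r ^ m := pow_pos hr m
  have hnum : 0 < σ * a + σ * φ θ * r ^ m := by
    rcases hne.lt_or_gt with h | h
    · have h1 := mul_nonpos_of_nonpos_of_nonneg (hi h) hk.le
      nlinarith [mul_pos ha hD]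
    · linarith [mul_nonneg (hii h) hk.le]
  have heq : σ * polarRHS a φ ψ (m + 1) θ r
      = r * (σ * a + σ * φ θ * r ^ m) / (1 + ψ θ * r ^ m) := by
    simp only [polarRHS, Nat.add_sub_cancel]
    ring
  rw [heq]
  positivity

/-- **Corollary 1.** Consider the planar system `x' = ax − y + Pₙ(x,y)`,
`y' = x + ay + Qₙ(x,y)` with `Pₙ, Qₙ` homogeneous of degree `n ≥ 2`, and
`φ(θ) = Pₙ(cos θ, sin θ) cos θ + Qₙ(cos θ, sin θ) sin θ`,
`ψ(θ) = Qₙ(cos θ, sin θ) cos θ − Pₙ(cos θ, sin θ) sin θ`, with `ψ` not identically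
zero. Assume `σ a > 0` with `σ = ±1` and, for each `θ ∈ [0,2π]`:
(i) if `ψ(θ) < 0` then `σ(aψ(θ) − φ(θ)) ≤ 0`; (ii) if `ψ(θ) > 0` then
`σ φ(θ) ≥ 0`; with the inequalities strict for all `θ` in a positive measure set
`P ⊆ [0,2π]`. Then the equation `dr/dθ = (ar + φ(θ)rⁿ)/(1 + ψ(θ)r^{n−1})` has no
positive `2π`-periodic limit cycle satisfying `1 + ψ(θ)r(θ)^{n−1} > 0` for all `θ`
(equivalently, the planar system has no limit cycle surrounding the origin). -/
theorem homogeneous_system_no_limit_cycle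
    (n : ℕ) (hn : 2 ≤ n) (a : ℝ)
    (Pn Qn : MvPolynomial (Fin 2) ℝ)
    (hPn : Pn.IsHomogeneous n) (hQn : Qn.IsHomogeneous n)
    (φ ψ : ℝ → ℝ)
    (hφ : ∀ θ, φ θ = MvPolynomial.eval ![cos θ, sin θ] Pn * cos θ
        + MvPolynomial.eval ![cos θ, sin θ] Qn * sin θ)
    (hψ : ∀ θ, ψ θ = MvPolynomial.eval ![cos θ, sin θ] Qn * cos θ
        - MvPolynomial.eval ![cos θ, sin θ] Pn * sin θ)
    (hψne : ∃ θ, ψ θ ≠ 0)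
    (σ : ℝ) (hσ : σ = 1 ∨ σ = -1) (ha : 0 < σ * a)
    (hi : ∀ θ ∈ Icc (0 : ℝ) (2 * π), ψ θ < 0 → σ * (a * ψ θ - φ θ) ≤ 0)
    (hii : ∀ θ ∈ Icc (0 : ℝ) (2 * π), 0 < ψ θ → 0 ≤ σ * φ θ)
    (P : Set ℝ) (hP : P ⊆ Icc (0 : ℝ) (2 * π)) (hPpos : 0 < volume P)
    (hPi : ∀ θ ∈ P, ψ θ < 0 → σ * (a * ψ θ - φ θ) < 0)
    (hPii : ∀ θ ∈ P, 0 < ψ θ → 0 < σ * φ θ) :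
    ¬ ∃ r : ℝ → ℝ, IsLimitCycle (polarRHS a φ ψ n) (2 * π) r ∧
        (∀ θ, 0 < r θ) ∧ (∀ θ, 0 < 1 + ψ θ * r θ ^ (n - 1)) := by
  rintro ⟨r, ⟨⟨hsol, hper⟩, -⟩, hr, hD⟩
  have hφa : ∀ θ, AnalyticAt ℝ φ θ := fun θ => by
    rw [funext hφ]
    exact ((analyticAt_eval_cos_sin Pn θ).mul analyticAt_cos).add
      ((analyticAt_eval_cos_sin Qn θ).mul analyticAt_sin)
  have hψa : ∀ θ, AnalyticAt ℝ ψ θ := fun θ => by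
    rw [funext hψ]
    exact ((analyticAt_eval_cos_sin Qn θ).mul analyticAt_cos).sub
      ((analyticAt_eval_cos_sin Pn θ).mul analyticAt_sin)
  have hev : ∀ θ, ∀ᶠ t in 𝓝[≠] θ, ψ t ≠ 0 := by
    intro θ
    by_contra hcon
    obtain ⟨θ₀, hθ₀⟩ := hψne
    have hfreq : ∃ᶠ t in 𝓝[≠] θ, ψ t = 0 := by
      simpa only [Filter.not_eventually, not_not] using hcon
    have hanal : AnalyticOnNhd ℝ ψ univ := fun t _ => hψa t
    exact hθ₀ (hanal.eqOn_zero_of_preconnected_of_frequently_eq_zero isPreconnected_univ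
      (mem_univ θ) hfreq (mem_univ θ₀))
  have hpos : ∀ θ ∈ Icc (0 : ℝ) (2 * π), ψ θ ≠ 0 → 0 < σ * polarRHS a φ ψ n θ (r θ) :=
    fun θ hθ => polarRHS_mul_pos (by omega) ha (hr θ) (hD θ) (hi θ hθ) (hii θ hθ)
  have hcont : Continuous fun θ => σ * polarRHS a φ ψ n θ (r θ) := by
    have hrc : Continuous r := continuous_iff_continuousAt.2 fun t => (hsol t).continuousAt
    have hφc : Continuous φ := continuous_iff_continuousAt.2 fun t => (hφa t).continuousAt
    have hψc : Continuous ψ := continuous_iff_continuousAt.2 fun t => (hψa t).continuousAt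
    unfold polarRHS
    exact continuous_const.mul (Continuous.div (by fun_prop) (by fun_prop) fun t => (hD t).ne')
  have hnn : ∀ θ ∈ Ioo (0 : ℝ) (2 * π), 0 ≤ σ * polarRHS a φ ψ n θ (r θ) := by
    intro θ hθ
    refine nonneg_of_eventually_nhdsNE
      (f := fun θ => σ * polarRHS a φ ψ n θ (r θ)) hcont.continuousAt ?_
    filter_upwards [hev θ, nhdsWithin_le_nhds (Icc_mem_nhds hθ.1 hθ.2)] with t ht htI
    exact (hpos t htI ht).le
  have hzero := deriv_eq_zero_of_nonneg_of_eq (g := fun θ => σ * r θ)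
    (fun t => (hsol t).const_mul σ) hnn (by simpa using congrArg (σ * ·) (hper 0).symm)
  have hπ : π ∈ Ioo (0 : ℝ) (2 * π) := ⟨pi_pos, by linarith [pi_pos]⟩
  obtain ⟨t, ht, htI⟩ :=
    ((hev π).and (nhdsWithin_le_nhds (Ioo_mem_nhds hπ.1 hπ.2))).exists
  exact (hpos t (Ioo_subset_Icc_self htI) ht).ne' (hzero t htI)
end

section
/- Assume a > 0 and that for each θ ∈ [0,2π]: (i) if ψ(θ) < 0 then aψ(θ) − φ(θ) ≥ 0; (ii) if ψ(θ) > 0 then φ(θ) ≥ 0; with the inequalities in (i) and (ii) strict for every θ in some subset of [0,2π] of positive Lebesgue measure. Then the equation dr/dθ = (ar + φ(θ)rⁿ)/(1 + ψ(θ)r^{n−1}) has at most one positive 2π-periodic limit cycle satisfying 1 + ψ(θ)r(θ)^{n−1} > 0 for all θ; equivalently, the planar system has at most one limit cycle surrounding the origin. The same conclusion holds when a < 0 with the inequality signs in (i) and (ii) reversed. -/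
open Real Set MeasureTheory

/-- A solution `r` of the polar equation of degree `m + 2` satisfies
`(r⁻⁽ᵐ⁺¹⁾)' = -(m + 1) (a + φ rᵐ⁺¹) / (rᵐ⁺¹ (1 + ψ rᵐ⁺¹))`. -/
lemma IsSolution.hasDerivAt_inv_pow {a : ℝ} {φ ψ : ℝ → ℝ} {m : ℕ} {r : ℝ → ℝ}
    (hr : IsSolution (polarRHS a φ ψ (m + 2)) r) (hpos : ∀ θ, 0 < r θ) (θ : ℝ) :
    HasDerivAt (fun t => (r t ^ (m + 1))⁻¹)
      (-(m + 1) * ((a + φ θ * r θ ^ (m + 1)) / (1 + ψ θ * r θ ^ (m + 1)) / r θ ^ (m + 1))) θ := by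
  have hne := (hpos θ).ne'
  refine (((hr θ).fun_pow (m + 1)).fun_inv (pow_ne_zero _ hne)).congr_deriv ?_
  simp only [polarRHS, Nat.add_sub_cancel, show m + 2 - 1 = m + 1 from rfl]
  rw [show a * r θ + φ θ * r θ ^ (m + 2) = r θ * (a + φ θ * r θ ^ (m + 1)) by ring]
  push_cast
  generalize 1 + ψ θ * r θ ^ (m + 1) = d
  rw [mul_div_assoc, div_eq_mul_inv _ d]
  field_simp
  ring

/-- The function `v ↦ (a v² + φ v) / (v + ψ)`, written in the variable `u = v⁻¹`, is injective
on the region `0 < u`, `0 < 1 + ψ u`. -/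
lemma eq_of_inv_polar_rate_eq {a φ ψ σ u v : ℝ} (ha : 0 < σ * a)
    (hneg : ψ < 0 → 0 ≤ σ * (a * ψ - φ)) (hpos : 0 < ψ → 0 ≤ σ * φ)
    (hu : 0 < u) (hv : 0 < v) (hu' : 0 < 1 + ψ * u) (hv' : 0 < 1 + ψ * v)
    (h : (a + φ * u) / (1 + ψ * u) / u = (a + φ * v) / (1 + ψ * v) / v) : u = v := by
  have key : 0 < σ * a * (1 + ψ * (u + v)) + σ * φ * ψ * (u * v) := by
    have huv := mul_pos hu hv
    rcases lt_trichotomy ψ 0 with hlt | rfl | hgt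
    · have h₁ := mul_pos ha (mul_pos hu' hv')
      have h₂ := mul_nonneg (mul_nonneg (hneg hlt) (neg_pos.2 hlt).le) huv.le
      linear_combination h₁ + h₂
    · simpa using ha
    · have h₁ := mul_nonneg (mul_nonneg (hpos hgt) hgt.le) huv.le
      have h₂ := mul_pos ha (show 0 < 1 + ψ * (u + v) by positivity)
      linarith
  rw [div_div, div_div, div_eq_div_iff (by positivity) (by positivity)] at h
  have hprod : (v - u) * (σ * a * (1 + ψ * (u + v)) + σ * φ * ψ * (u * v)) = 0 := by
    linear_combination σ * h
  rcases mul_eq_zero.1 hprod with h₀ | h₀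
  · linarith
  · exact absurd h₀ key.ne'

/-- Two periodic differentiable functions agree if, over one period, they agree wherever
their derivatives agree. -/
lemma Function.Periodic.eq_of_deriv_eq_imp_eq {f g f' g' : ℝ → ℝ} {T : ℝ} (hT : 0 < T)
    (hf : Function.Periodic f T) (hg : Function.Periodic g T)
    (hf' : ∀ t, HasDerivAt f (f' t) t) (hg' : ∀ t, HasDerivAt g (g' t) t)
    (h : ∀ t ∈ Icc 0 T, f' t = g' t → f t = g t) : f = g := by
  set D : ℝ → ℝ := fun t => (f t - g t) ^ 2 with hD
  have hD' (t : ℝ) : HasDerivAt D (2 * (f t - g t) * (f' t - g' t)) t := by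
    simpa using ((hf' t).fun_sub (hg' t)).fun_pow 2
  have hper : Function.Periodic D T := fun t => by simp only [hD, hf t, hg t]
  obtain ⟨t₀, ht₀, hmax⟩ := isCompact_Icc.exists_isMaxOn (nonempty_Icc.2 hT.le)
    (continuous_iff_continuousAt.2 fun t => (hD' t).continuousAt).continuousOn
  have hle (t : ℝ) : D t ≤ D t₀ := by
    obtain ⟨s, hs, hst⟩ := hper.exists_mem_Ico₀ hT t
    exact hst ▸ hmax (Ico_subset_Icc_self hs)
  have hcrit := IsLocalMax.hasDerivAt_eq_zero (Filter.Eventually.of_forall hle) (hD' t₀)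
  have heq : f t₀ = g t₀ := by
    rcases mul_eq_zero.1 hcrit with h₀ | h₀
    · linarith
    · exact h t₀ ht₀ (sub_eq_zero.1 h₀)
  funext t
  have ht := hle t
  simp only [hD, heq, sub_self, ne_eq, OfNat.ofNat_ne_zero, not_false_eq_true, zero_pow] at ht
  exact sub_eq_zero.1 (pow_eq_zero_iff two_ne_zero |>.1 (le_antisymm ht (sq_nonneg _)))

/-- **Corollary 2.** Consider the planar system `x' = ax − y + Pₙ(x,y)`,
`y' = x + ay + Qₙ(x,y)` with `Pₙ, Qₙ` homogeneous of degree `n ≥ 2`, and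
`φ(θ) = Pₙ(cos θ, sin θ) cos θ + Qₙ(cos θ, sin θ) sin θ`,
`ψ(θ) = Qₙ(cos θ, sin θ) cos θ − Pₙ(cos θ, sin θ) sin θ`, with `ψ` not identically
zero. Assume `σ a > 0` with `σ = ±1` and, for each `θ ∈ [0,2π]`:
(i) if `ψ(θ) < 0` then `σ(aψ(θ) − φ(θ)) ≥ 0`; (ii) if `ψ(θ) > 0` then
`σ φ(θ) ≥ 0`; with the inequalities strict for all `θ` in a positive measure set
`P ⊆ [0,2π]`. Then the equation `dr/dθ = (ar + φ(θ)rⁿ)/(1 + ψ(θ)r^{n−1})` has at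
most one positive `2π`-periodic limit cycle satisfying `1 + ψ(θ)r(θ)^{n−1} > 0` for
all `θ` (equivalently, the planar system has at most one limit cycle surrounding
the origin). -/
theorem homogeneous_system_at_most_one_limit_cycle
    (n : ℕ) (hn : 2 ≤ n) (a : ℝ)
    (Pn Qn : MvPolynomial (Fin 2) ℝ)
    (hPn : Pn.IsHomogeneous n) (hQn : Qn.IsHomogeneous n)
    (φ ψ : ℝ → ℝ)
    (hφ : ∀ θ, φ θ = MvPolynomial.eval ![cos θ, sin θ] Pn * cos θ
        + MvPolynomial.eval ![cos θ, sin θ] Qn * sin θ)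
    (hψ : ∀ θ, ψ θ = MvPolynomial.eval ![cos θ, sin θ] Qn * cos θ
        - MvPolynomial.eval ![cos θ, sin θ] Pn * sin θ)
    (hψne : ∃ θ, ψ θ ≠ 0)
    (σ : ℝ) (hσ : σ = 1 ∨ σ = -1) (ha : 0 < σ * a)
    (hi : ∀ θ ∈ Icc (0 : ℝ) (2 * π), ψ θ < 0 → 0 ≤ σ * (a * ψ θ - φ θ))
    (hii : ∀ θ ∈ Icc (0 : ℝ) (2 * π), 0 < ψ θ → 0 ≤ σ * φ θ)
    (P : Set ℝ) (hP : P ⊆ Icc (0 : ℝ) (2 * π)) (hPpos : 0 < volume P)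
    (hPi : ∀ θ ∈ P, ψ θ < 0 → 0 < σ * (a * ψ θ - φ θ))
    (hPii : ∀ θ ∈ P, 0 < ψ θ → 0 < σ * φ θ) :
    ∀ r₁ r₂ : ℝ → ℝ,
      IsLimitCycle (polarRHS a φ ψ n) (2 * π) r₁ →
        (∀ θ, 0 < r₁ θ) → (∀ θ, 0 < 1 + ψ θ * r₁ θ ^ (n - 1)) →
      IsLimitCycle (polarRHS a φ ψ n) (2 * π) r₂ →
        (∀ θ, 0 < r₂ θ) → (∀ θ, 0 < 1 + ψ θ * r₂ θ ^ (n - 1)) →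
      r₁ = r₂ := by
  intro r₁ r₂ h₁ hpos₁ hden₁ h₂ hpos₂ hden₂
  obtain ⟨m, rfl⟩ := Nat.exists_eq_add_of_le' hn
  have hinv : (fun θ => (r₁ θ ^ (m + 1))⁻¹) = fun θ => (r₂ θ ^ (m + 1))⁻¹ := by
    refine Function.Periodic.eq_of_deriv_eq_imp_eq two_pi_pos
      (fun θ => by simp only [h₁.1.2 θ]) (fun θ => by simp only [h₂.1.2 θ])
      (h₁.1.1.hasDerivAt_inv_pow hpos₁) (h₂.1.1.hasDerivAt_inv_pow hpos₂) fun θ hθ h => ?_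
    exact congrArg _ (eq_of_inv_polar_rate_eq ha (hi θ hθ) (hii θ hθ) (pow_pos (hpos₁ θ) _)
      (pow_pos (hpos₂ θ) _) (hden₁ θ) (hden₂ θ)
      (mul_left_cancel₀ (neg_ne_zero.2 m.cast_add_one_ne_zero) h))
  funext θ
  exact (pow_left_inj₀ (hpos₁ θ).le (hpos₂ θ).le m.succ_ne_zero).1 (inv_injective (congrFun hinv θ))
end

section
/- Define the polynomials P_ψ(t) = (t − 1)·t·(17649 + 9269t + 20000t²)/20000 and P_φ(t) = (10t − 9)(10t − 1)(1 − 10t + 50t²)/10000, and let a = 1/2. Then for every t ∈ ℝ: (i) if P_ψ(t) < 0 then a·P_ψ(t) − P_φ(t) ≤ 0; and (ii) if P_ψ(t) > 0 then P_φ(t) ≥ 0. Moreover, P_ψ(t) ≤ 0 exactly for t ∈ [0,1] (with zeros only at t = 0 and t = 1), and P_φ(t) < 0 exactly for t ∈ (1/10, 9/10). -/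
open Set

/-- **Sign conditions of Example 2.** For
`P_ψ(t) = (t − 1)·t·(17649 + 9269t + 20000t²)/20000`,
`P_φ(t) = (10t − 9)(10t − 1)(1 − 10t + 50t²)/10000` and `a = 1/2`:
(i) if `P_ψ(t) < 0` then `a P_ψ(t) − P_φ(t) ≤ 0`;
(ii) if `P_ψ(t) > 0` then `P_φ(t) ≥ 0`;
moreover `P_ψ(t) ≤ 0` exactly for `t ∈ [0,1]` (with zeros only at `t = 0` and
`t = 1`), and `P_φ(t) < 0` exactly for `t ∈ (1/10, 9/10)`. -/
theorem example_sign_conditions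
    (Pψ Pφ : ℝ → ℝ) (a : ℝ)
    (hPψ : ∀ t, Pψ t = (t - 1) * t * (17649 + 9269 * t + 20000 * t ^ 2) / 20000)
    (hPφ : ∀ t, Pφ t = (10 * t - 9) * (10 * t - 1) * (1 - 10 * t + 50 * t ^ 2) / 10000)
    (ha : a = 1 / 2) :
    (∀ t, Pψ t < 0 → a * Pψ t - Pφ t ≤ 0) ∧
    (∀ t, 0 < Pψ t → 0 ≤ Pφ t) ∧
    (∀ t, Pψ t ≤ 0 ↔ t ∈ Icc (0 : ℝ) 1) ∧
    (∀ t, Pψ t = 0 ↔ t = 0 ∨ t = 1) ∧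
    (∀ t, Pφ t < 0 ↔ t ∈ Ioo (1 / 10 : ℝ) (9 / 10)) := by
  have hq (t : ℝ) : 0 < (17649 + 9269 * t + 20000 * t ^ 2) / 20000 := by
    nlinarith [sq_nonneg (t + 9269 / 40000)]
  have hr (t : ℝ) : 0 < (1 - 10 * t + 50 * t ^ 2) / 10000 := by
    nlinarith [sq_nonneg (10 * t - 1)]
  have hψ_nonpos (t : ℝ) : Pψ t ≤ 0 ↔ t ∈ Icc (0 : ℝ) 1 := by
    rw [hPψ, mul_div_assoc, ← not_lt, mul_pos_iff_of_pos_right (hq t), not_lt, mem_Icc]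
    constructor
    · intro h
      constructor <;> nlinarith
    · rintro ⟨h0, h1⟩
      nlinarith
  have hφ_neg (t : ℝ) : Pφ t < 0 ↔ t ∈ Ioo (1 / 10 : ℝ) (9 / 10) := by
    rw [hPφ, mul_div_assoc, ← not_le, mul_nonneg_iff_of_pos_right (hr t), not_le, mem_Ioo]
    constructor
    · intro h
      constructor <;> nlinarith
    · rintro ⟨h0, h1⟩
      nlinarith
  refine ⟨fun t ht => ?_, fun t ht => ?_, hψ_nonpos, fun t => ?_, hφ_neg⟩
  · obtain ⟨h0, h1⟩ := (hψ_nonpos t).1 ht.le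
    have h2 : t ^ 2 ≤ t := by nlinarith
    have h3 : t ^ 3 ≤ t := by nlinarith
    rw [hPψ, hPφ, ha]
    linarith
  · by_contra! h
    obtain ⟨h0, h1⟩ := (hφ_neg t).1 h
    exact ht.not_ge ((hψ_nonpos t).2 ⟨by linarith, by linarith⟩)
  · rw [hPψ, mul_div_assoc, mul_eq_zero_iff_right (hq t).ne', mul_eq_zero, sub_eq_zero, or_comm]
end
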